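/- arXiv:2003.03661 — 2 statements merged into one kernel-verified Lean document; each statement's English description precedes it below -/
import Mathlib

section
/- (Adjoining Primes) Let L_i(m) = a_i m + b_i for i = 1, …, k be an admissible k-tuple of linear forms, and suppose that for each pair i ≠ j there are positive integers c_{i,j}, c_{j,i}, n_{i,j} such that c_{i,j}·L_i(m) − c_{j,i}·L_j(m) = ±n_{i,j} holds identically in m. Then for every choice of positive integers r₁, …, r_k satisfying gcd(r_i, a_i) = 1, gcd(r_i, |a_i b_j − a_j b_i|) = 1, and gcd(r_i, r_j) = 1 whenever i ≠ j, there exists an admissible k-tuple of linear forms K₁, …, K_k such that c_{i,j}·r_i·K_i(m) − c_{j,i}·r_j·K_j(m) = ±n_{i,j} holds identically in m for every pair i ≠ j. -/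
/-- Linear congruences `a i * x ≡ v i` modulo pairwise coprime moduli `M i` prime to the `a i` have
a common solution. -/
theorem Int.exists_forall_dvd_mul_sub {ι : Type*} [Fintype ι] (a v M : ι → ℤ)
    (hMa : ∀ i, IsCoprime (M i) (a i)) (hM : ∀ i j, i ≠ j → IsCoprime (M i) (M j)) :
    ∃ x : ℤ, ∀ i, M i ∣ a i * x - v i := by
  choose u w huw using hMa
  obtain ⟨x, hx⟩ := Ideal.exists_forall_sub_mem_ideal
    (I := fun i => Ideal.span {M i})
    (fun i j hij => (Ideal.isCoprime_span_singleton_iff _ _).2 (hM i j hij))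
    (fun i => w i * v i)
  refine ⟨x, fun i => ?_⟩
  obtain ⟨y, hy⟩ := Ideal.mem_span_singleton.1 (hx i)
  exact ⟨a i * y - u i * v i, by linear_combination a i * hy + v i * huw i⟩

/-- Adjoining primes to the relation coefficients of an admissible tuple of linear forms. -/
theorem stmt_1 (k : ℕ) (a b : Fin k → ℤ) (ha : ∀ i, 0 < a i)
    (hadm : ∀ p : ℕ, p.Prime → ∃ t : ℤ, ¬ ((p : ℤ) ∣ ∏ i, (a i * t + b i)))
    (c n : Fin k → Fin k → ℕ)
    (hc : ∀ i j, i ≠ j → 0 < c i j) (hn : ∀ i j, i ≠ j → 0 < n i j)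
    (hrel : ∀ i j, i ≠ j → ∀ m : ℤ,
      |(c i j : ℤ) * (a i * m + b i) - (c j i : ℤ) * (a j * m + b j)| = n i j)
    (r : Fin k → ℕ) (hr : ∀ i, 0 < r i)
    (hra : ∀ i, IsCoprime (r i : ℤ) (a i))
    (hrdet : ∀ i j, i ≠ j → IsCoprime (r i : ℤ) (a i * b j - a j * b i))
    (hrr : ∀ i j, i ≠ j → Nat.Coprime (r i) (r j)) :
    ∃ A B : Fin k → ℤ, (∀ i, 0 < A i) ∧
      (∀ p : ℕ, p.Prime → ∃ t : ℤ, ¬ ((p : ℤ) ∣ ∏ i, (A i * t + B i))) ∧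
      (∀ i j, i ≠ j → ∀ m : ℤ,
        |(c i j : ℤ) * (r i : ℤ) * (A i * m + B i) -
          (c j i : ℤ) * (r j : ℤ) * (A j * m + B j)| = n i j) := by
  obtain ⟨x, hx⟩ := Int.exists_forall_dvd_mul_sub a (fun i => (r i : ℤ) - b i)
    (fun i => (r i : ℤ) ^ 2) (fun i => (hra i).pow_left)
    (fun i j hij => (Nat.isCoprime_iff_coprime.2 (hrr i j hij)).pow)
  choose s hs using hx
  set R : ℤ := ∏ i, (r i : ℤ)
  have hRpos : 0 < R := Finset.prod_pos fun i _ => by exact_mod_cast hr i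
  have hdvd : ∀ i, (r i : ℤ) ∣ R := fun i => Finset.dvd_prod_of_mem _ (Finset.mem_univ i)
  choose e he using hdvd
  have hepos : ∀ i, 0 < e i := fun i =>
    pos_of_mul_pos_right (he i ▸ hRpos) (Int.natCast_nonneg _)
  have key : ∀ i m, (r i : ℤ) * (a i * e i * R * m + (1 + r i * s i)) =
      a i * (R ^ 2 * m + x) + b i := fun i m => by
    linear_combination - hs i - a i * R * m * he i
  refine ⟨fun i => a i * e i * R, fun i => 1 + r i * s i,
    fun i => mul_pos (mul_pos (ha i) (hepos i)) hRpos, fun p hp => ?_, fun i j hij m => ?_⟩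
  · have hpp : Prime (p : ℤ) := Nat.prime_iff_prime_int.1 hp
    by_cases hpR : (p : ℤ) ∣ R
    · obtain ⟨i, -, hi⟩ := hpp.exists_mem_finset_dvd hpR
      refine ⟨0, fun h => ?_⟩
      obtain ⟨j, -, hj⟩ := hpp.exists_mem_finset_dvd h
      simp only [mul_zero, zero_add] at hj
      by_cases hij : i = j
      · subst hij
        exact hpp.not_dvd_one ((Int.dvd_add_left (hi.mul_right _)).1 hj)
      · have hLi : (p : ℤ) ∣ a i * x + b i := by
          have h := hi.mul_right (a i * e i * R * 0 + (1 + r i * s i))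
          rwa [key, mul_zero, zero_add] at h
        have hLj : (p : ℤ) ∣ a j * x + b j := by
          have h := hj.mul_left (r j : ℤ)
          have hk := key j 0
          simp only [mul_zero, zero_add] at hk
          rwa [hk] at h
        have hdet : (p : ℤ) ∣ a i * b j - a j * b i := by
          have h := dvd_sub (hLj.mul_left (a i)) (hLi.mul_left (a j))
          rwa [show a i * (a j * x + b j) - a j * (a i * x + b i) = a i * b j - a j * b i by
            ring] at h
        exact hpp.not_isUnit ((hrdet i j hij).isUnit_of_dvd' hi hdet)
    · obtain ⟨t, ht⟩ := hadm p hp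
      obtain ⟨u, w, huw⟩ : IsCoprime (R ^ 2) (p : ℤ) :=
        ((hpp.coprime_iff_not_dvd).2 hpR).symm.pow_left
      refine ⟨u * (t - x), fun h => ht ?_⟩
      obtain ⟨j, -, hj⟩ := hpp.exists_mem_finset_dvd h
      refine dvd_trans ?_ (Finset.dvd_prod_of_mem _ (Finset.mem_univ j))
      have h' := hj.mul_left (r j : ℤ)
      rw [key] at h'
      have heq : a j * t + b j = a j * (R ^ 2 * (u * (t - x)) + x) + b j +
          p * (a j * w * (t - x)) := by
        linear_combination -a j * (t - x) * huw
      rw [heq]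
      exact dvd_add h' (dvd_mul_right _ _)
  · rw [mul_assoc, mul_assoc (c j i : ℤ), key, key]
    exact hrel i j hij _
end

section
/- For every positive integer n, there are infinitely many positive integers x such that x and x + n have the same exponent pattern. -/
/-- The exponent pattern of a positive integer: the multiset of nonzero exponents
in its prime factorization. -/
def exponentPattern (m : ℕ) : Multiset ℕ :=
  m.factorization.support.val.map fun p => m.factorization p

open Finset

/-- The set of the first `k` primes. -/
noncomputable def firstPrimes (k : ℕ) : Finset ℕ :=
  (range k).image (Nat.nth Nat.Prime)

lemma nth_prime_le_two_pow (k : ℕ) : Nat.nth Nat.Prime k ≤ 2 ^ (k + 1) := by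
  induction k with
  | zero => simp [Nat.nth_prime_zero_eq_two]
  | succ k ih =>
    obtain ⟨p, hp, h1, h2⟩ := Nat.exists_prime_lt_and_le_two_mul (Nat.nth Nat.Prime k)
      (Nat.prime_nth_prime k).ne_zero
    have h3 : k < Nat.count Nat.Prime p := by
      have := Nat.count_strict_mono (p := Nat.Prime) (Nat.prime_nth_prime k) h1
      rwa [Nat.count_nth_of_infinite Nat.infinite_setOfPred_prime] at this
    have h4 : Nat.nth Nat.Prime (k + 1) ≤ p := by
      rw [← Nat.nth_count hp]
      exact Nat.nth_monotone Nat.infinite_setOfPred_prime h3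
    calc _ ≤ p := h4
      _ ≤ 2 * 2 ^ (k + 1) := by omega
      _ = 2 ^ (k + 1 + 1) := by ring

lemma nth_prime_injective : Function.Injective (Nat.nth Nat.Prime) :=
  Nat.nth_injective Nat.infinite_setOfPred_prime

lemma card_firstPrimes (k : ℕ) : #(firstPrimes k) = k := by
  rw [firstPrimes, card_image_of_injective _ nth_prime_injective, card_range]

lemma prime_of_mem_firstPrimes {k q : ℕ} (hq : q ∈ firstPrimes k) : q.Prime := by
  obtain ⟨i, -, rfl⟩ := mem_image.1 hq
  exact Nat.prime_nth_prime i

lemma le_of_mem_firstPrimes {k q : ℕ} (hq : q ∈ firstPrimes k) : q ≤ 2 ^ k := by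
  obtain ⟨i, hi, rfl⟩ := mem_image.1 hq
  exact (nth_prime_le_two_pow i).trans (Nat.pow_le_pow_right (by norm_num) (mem_range.1 hi))

lemma lt_of_notMem_firstPrimes {k q : ℕ} (hq : q.Prime) (h : q ∉ firstPrimes k) : k < q := by
  by_contra! hle
  refine h (mem_image.2 ⟨Nat.count Nat.Prime q, mem_range.2 ?_, Nat.nth_count hq⟩)
  have := Nat.add_two_le_nth_prime (Nat.count Nat.Prime q)
  rw [Nat.nth_count hq] at this
  omega

lemma prod_firstPrimes_le (k : ℕ) : ∏ q ∈ firstPrimes k, q ≤ 2 ^ (k * k) := by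
  calc ∏ q ∈ firstPrimes k, q ≤ ∏ _q ∈ firstPrimes k, 2 ^ k :=
        prod_le_prod' fun q hq => le_of_mem_firstPrimes hq
    _ = 2 ^ (k * k) := by rw [prod_const, card_firstPrimes, ← pow_mul]

lemma card_filter_dvd_le {a b d X : ℕ} (h : d.Coprime a) :
    #{t ∈ range X | d ∣ a * t + b} ≤ X / d + 1 := by
  rw [← card_range (X / d + 1)]
  refine card_le_card_of_injOn (fun t => t / d) (fun t ht => ?_) (fun t ht s hs hts => ?_)
  · simp only [coe_filter, mem_range, Set.mem_ofPred_eq] at ht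
    simp only [coe_range, Set.mem_Iio]
    exact Nat.lt_succ_of_le (Nat.div_le_div_right ht.1.le)
  · simp only [coe_filter, mem_range, Set.mem_ofPred_eq] at ht hs
    have h1 : a * t + b ≡ a * s + b [MOD d] :=
      ((Nat.modEq_zero_iff_dvd.2 ht.2).trans (Nat.modEq_zero_iff_dvd.2 hs.2).symm)
    have h2 : t ≡ s [MOD d] := Nat.ModEq.cancel_left_of_coprime h (Nat.ModEq.add_right_cancel' b h1)
    rw [← Nat.div_add_mod t d, ← Nat.div_add_mod s d, h2]
    simp only at hts
    rw [hts]

open scoped Classical in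
lemma card_sq_dvd_le {a b X Z z : ℕ} (hz : 0 < z)
    (hb : ∀ t < X, 0 < a * t + b ∧ a * t + b ≤ Z ^ 2) :
    (#{t ∈ range X | ∃ l, z < l ∧ l.Coprime a ∧ l ^ 2 ∣ a * t + b} : ℝ) ≤ X / z + Z := by
  have h1 : ({t ∈ range X | ∃ l, z < l ∧ l.Coprime a ∧ l ^ 2 ∣ a * t + b} : Finset ℕ) ⊆
      ((Ioc z Z).filter fun l => l.Coprime a).biUnion fun l =>
        {t ∈ range X | l ^ 2 ∣ a * t + b} := by
    intro t ht
    simp only [mem_filter, mem_range] at ht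
    obtain ⟨hX, l, hl, hc, hd⟩ := ht
    simp only [mem_biUnion, mem_filter, mem_range, mem_Ioc]
    refine ⟨l, ⟨⟨hl, ?_⟩, hc⟩, hX, hd⟩
    have := (Nat.le_of_dvd (hb t hX).1 hd).trans (hb t hX).2
    exact (Nat.pow_le_pow_iff_left (by norm_num)).1 this
  have h2 : (#{t ∈ range X | ∃ l, z < l ∧ l.Coprime a ∧ l ^ 2 ∣ a * t + b} : ℝ) ≤
      ∑ l ∈ Ioc z Z, ((X : ℝ) * ((l : ℝ) ^ 2)⁻¹ + 1) := by
    calc _ ≤ ((∑ l ∈ (Ioc z Z).filter fun l => l.Coprime a,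
          #{t ∈ range X | l ^ 2 ∣ a * t + b} : ℕ) : ℝ) := by
          exact_mod_cast (card_le_card h1).trans card_biUnion_le
      _ ≤ ∑ l ∈ (Ioc z Z).filter fun l => l.Coprime a, ((X : ℝ) * ((l : ℝ) ^ 2)⁻¹ + 1) := by
          push_cast
          refine sum_le_sum fun l hl => ?_
          simp only [mem_filter, mem_Ioc] at hl
          have hl0 : 0 < l := by omega
          have h3 : (#{t ∈ range X | l ^ 2 ∣ a * t + b} : ℝ) ≤ ((X / l ^ 2 + 1 : ℕ) : ℝ) := by
            exact_mod_cast card_filter_dvd_le (Nat.Coprime.pow_left 2 hl.2)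
          have h4 : ((X / l ^ 2 : ℕ) : ℝ) ≤ X / ((l ^ 2 : ℕ) : ℝ) := Nat.cast_div_le
          push_cast at h3 h4
          rw [← div_eq_mul_inv]
          linarith
      _ ≤ _ := sum_le_sum_of_subset_of_nonneg (filter_subset _ _) fun _ _ _ => by positivity
  refine h2.trans ?_
  rcases le_total z Z with h | h
  · rw [sum_add_distrib, ← mul_sum]
    have := sum_Ioc_inv_sq_le_sub (α := ℝ) hz.ne' h
    have h5 : (0 : ℝ) ≤ (Z : ℝ)⁻¹ := by positivity
    have h6 : (X : ℝ) * ∑ l ∈ Ioc z Z, ((l : ℝ) ^ 2)⁻¹ ≤ X * (z : ℝ)⁻¹ := by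
      gcongr; linarith
    simp only [sum_const, Nat.card_Ioc, nsmul_eq_mul, mul_one]
    have h7 : ((Z - z : ℕ) : ℝ) ≤ Z := by exact_mod_cast Nat.sub_le _ _
    rw [div_eq_mul_inv]; linarith
  · rw [Ioc_eq_empty (by omega)]; simp; positivity

lemma two_pow_card_le {S : Finset ℕ} (hS : ∀ l ∈ S, l.Prime) {m Z P : ℕ} (hm : 0 < m)
    (hZ : m ≤ Z ^ 2) (hdvd : ∀ l ∈ S, l ∣ m) (hP : ∀ l ∈ S, l.Coprime P) :
    2 ^ #S ≤ 2 * #{d ∈ Icc 1 Z | d.Coprime P ∧ d ∣ m} := by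
  classical
  set U := {T ∈ S.powerset | (∏ l ∈ T, l) ≤ Z} with hU
  have h1 : S.powerset ⊆ U ∪ U.image (S \ ·) := by
    intro T hT
    rw [mem_powerset] at hT
    by_cases h : (∏ l ∈ T, l) ≤ Z
    · exact mem_union_left _ (by simp [hU, hT, h])
    · refine mem_union_right _ (mem_image.2 ⟨S \ T, ?_, by simpa using hT⟩)
      simp only [hU, mem_filter, mem_powerset, sdiff_subset, true_and]
      by_contra h'
      have h2 : (∏ l ∈ S \ T, l) * ∏ l ∈ T, l = ∏ l ∈ S, l := prod_sdiff hT
      have h3 : ∏ l ∈ S, l ≤ m :=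
        Nat.le_of_dvd hm (prod_primes_dvd m (fun l hl => (hS l hl).prime) hdvd)
      have h4 : Z * Z < (∏ l ∈ S \ T, l) * ∏ l ∈ T, l :=
        Nat.mul_lt_mul'' (not_le.1 h') (not_le.1 h)
      nlinarith
  have h2 : 2 ^ #S ≤ 2 * #U := by
    rw [← card_powerset]
    calc _ ≤ #U + #(U.image (S \ ·)) := (card_le_card h1).trans (card_union_le _ _)
      _ ≤ _ := by have := card_image_le (s := U) (f := (S \ ·)); omega
  refine h2.trans (Nat.mul_le_mul_left 2 ?_)
  refine card_le_card_of_injOn (fun T => ∏ l ∈ T, l) (fun T hT => ?_) (fun T hT T' hT' h => ?_)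
  · simp only [hU, coe_filter, mem_powerset, Set.mem_ofPred_eq] at hT
    simp only [coe_filter, mem_Icc, Set.mem_ofPred_eq]
    refine ⟨⟨Nat.pos_of_ne_zero (prod_ne_zero_iff.2 fun l hl => (hS l (hT.1 hl)).ne_zero), hT.2⟩,
      Nat.Coprime.prod_left fun l hl => hP l (hT.1 hl), ?_⟩
    exact prod_primes_dvd m (fun l hl => (hS l (hT.1 hl)).prime) fun l hl => hdvd l (hT.1 hl)
  · simp only [hU, coe_filter, mem_powerset, Set.mem_ofPred_eq] at hT hT'
    rw [← Nat.primeFactors_prod fun l hl => hS l (hT.1 hl),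
      ← Nat.primeFactors_prod fun l hl => hS l (hT'.1 hl)]
    exact congrArg _ h

lemma exists_forall_not_dvd {ι : Type*} (s : Finset ι) (a b : ι → ℤ) {l : ℕ} (hl : l.Prime)
    (hs : #s < l) (ha : ∀ k ∈ s, ¬ (l : ℤ) ∣ a k) :
    ∃ y : ℕ, ∀ k ∈ s, ¬ (l : ℤ) ∣ a k * y + b k := by
  classical
  by_contra! h
  choose f hf using h
  obtain ⟨x, hx, y, hy, hxy, he⟩ := exists_ne_map_eq_of_card_lt_of_maps_to
    (s := range l) (t := s) (by simpa using hs) (f := f) (fun y _ => (hf y).1)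
  have h1 := dvd_sub (hf x).2 (he ▸ (hf y).2)
  rw [show a (f x) * (x : ℤ) + b (f x) - (a (f x) * y + b (f x)) = a (f x) * (x - y) by ring] at h1
  rcases (Nat.prime_iff_prime_int.1 hl).dvd_or_dvd h1 with h2 | h2
  · exact ha _ (hf x).1 h2
  · have h3 := (Nat.modEq_iff_dvd.2 h2).symm
    rw [Nat.ModEq, Nat.mod_eq_of_lt (by simpa using hx), Nat.mod_eq_of_lt (by simpa using hy)] at h3
    exact hxy h3

lemma exists_modEq_of_primes (L : Finset ℕ) (hL : ∀ l ∈ L, l.Prime) (k r : ℕ → ℕ) :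
    ∃ N < ∏ l ∈ L, l ^ k l, ∀ l ∈ L, N ≡ r l [MOD l ^ k l] := by
  have hne : ∀ l ∈ L, l ^ k l ≠ 0 := fun l hl => pow_ne_zero _ (hL l hl).ne_zero
  have hco : Set.Pairwise (L : Set ℕ) (Function.onFun Nat.Coprime fun l => l ^ k l) :=
    fun x hx y hy hxy => Nat.Coprime.pow _ _ ((Nat.coprime_primes (hL x hx) (hL y hy)).2 hxy)
  exact ⟨_, Nat.chineseRemainderOfFinset_lt_prod r (fun l => l ^ k l) hne hco,
    (Nat.chineseRemainderOfFinset r (fun l => l ^ k l) L hne hco).2⟩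

lemma sum_inv_le_of_le_two_pow {Z L : ℕ} (h : Z ≤ 2 ^ L) :
    ∑ d ∈ Icc 1 Z, ((d : ℝ))⁻¹ ≤ 1 + L := by
  have h1 := harmonic_le_one_add_log Z
  rw [harmonic_eq_sum_Icc] at h1
  push_cast at h1
  refine h1.trans ?_
  gcongr
  rcases Nat.eq_zero_or_pos Z with rfl | hZ
  · simp
  calc Real.log Z ≤ Real.log (2 ^ L) :=
        Real.log_le_log (by exact_mod_cast hZ) (by exact_mod_cast h)
    _ = L * Real.log 2 := by rw [Real.log_pow]
    _ ≤ L * 1 := by gcongr; linarith [Real.log_two_lt_d9]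
    _ = L := mul_one _

open scoped Classical in
lemma card_two_pow_le {a b X Z L V : ℕ} (hV : 0 < V) (hZX : Z ≤ X) (hZ : Z ≤ 2 ^ L)
    (hb : ∀ t < X, 0 < a * t + b ∧ a * t + b ≤ Z ^ 2) :
    (#{t ∈ range X | V ≤ 2 ^ #{l ∈ (a * t + b).primeFactors | ¬ l ∣ a}} : ℝ) ≤
      2 * X * (2 + L) / V := by
  rw [le_div_iff₀ (by exact_mod_cast hV)]
  have h1 : #{t ∈ range X | V ≤ 2 ^ #{l ∈ (a * t + b).primeFactors | ¬ l ∣ a}} * V ≤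
      ∑ t ∈ range X, 2 * #{d ∈ Icc 1 Z | d.Coprime a ∧ d ∣ a * t + b} := by
    rw [← smul_eq_mul]
    refine (card_nsmul_le_sum _ (fun t => 2 ^ #{l ∈ (a * t + b).primeFactors | ¬ l ∣ a}) V
      fun t ht => (mem_filter.1 ht).2).trans ?_
    refine (sum_le_sum_of_subset (filter_subset _ _)).trans (sum_le_sum fun t ht => ?_)
    rw [mem_range] at ht
    refine two_pow_card_le (fun l hl => ?_) (hb t ht).1 (hb t ht).2 (fun l hl => ?_) fun l hl => ?_
    · exact Nat.prime_of_mem_primeFactors (mem_filter.1 hl).1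
    · exact Nat.dvd_of_mem_primeFactors (mem_filter.1 hl).1
    · exact (Nat.Prime.coprime_iff_not_dvd (Nat.prime_of_mem_primeFactors (mem_filter.1 hl).1)).2
        (mem_filter.1 hl).2
  have h2 : ∑ t ∈ range X, #{d ∈ Icc 1 Z | d.Coprime a ∧ d ∣ a * t + b} =
      ∑ d ∈ Icc 1 Z, #{t ∈ range X | d.Coprime a ∧ d ∣ a * t + b} :=
    sum_card_bipartiteAbove_eq_sum_card_bipartiteBelow _
  have h3 : ((∑ d ∈ Icc 1 Z, #{t ∈ range X | d.Coprime a ∧ d ∣ a * t + b} : ℕ) : ℝ) ≤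
      ∑ d ∈ Icc 1 Z, ((X : ℝ) * (d : ℝ)⁻¹ + 1) := by
    push_cast
    refine sum_le_sum fun d _ => ?_
    by_cases hd : d.Coprime a
    · have h4 : (#{t ∈ range X | d ∣ a * t + b} : ℝ) ≤ ((X / d + 1 : ℕ) : ℝ) := by
        exact_mod_cast card_filter_dvd_le hd
      have h5 : ((X / d : ℕ) : ℝ) ≤ X / (d : ℝ) := Nat.cast_div_le
      push_cast at h4
      rw [← div_eq_mul_inv]
      have h9 : #{t ∈ range X | d.Coprime a ∧ d ∣ a * t + b} ≤ #{t ∈ range X | d ∣ a * t + b} :=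
        card_le_card (monotone_filter_right _ fun t _ h => h.2)
      have h10 : (#{t ∈ range X | d.Coprime a ∧ d ∣ a * t + b} : ℝ) ≤
        #{t ∈ range X | d ∣ a * t + b} := by exact_mod_cast h9
      linarith
    · rw [filter_false_of_mem fun t _ h => hd h.1, card_empty, Nat.cast_zero]
      positivity
  rw [sum_add_distrib, ← mul_sum] at h3
  simp only [sum_const, Nat.card_Icc, nsmul_eq_mul, mul_one, Nat.add_sub_cancel] at h3
  have h6 : (X : ℝ) * ∑ d ∈ Icc 1 Z, ((d : ℝ))⁻¹ ≤ X * (1 + L) := by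
    gcongr; exact sum_inv_le_of_le_two_pow hZ
  have h7 : (Z : ℝ) ≤ X := by exact_mod_cast hZX
  rw [← mul_sum, h2] at h1
  have h8 : (#{t ∈ range X | V ≤ 2 ^ #{l ∈ (a * t + b).primeFactors | ¬ l ∣ a}} : ℝ) * V ≤
      2 * ((∑ d ∈ Icc 1 Z, #{t ∈ range X | d.Coprime a ∧ d ∣ a * t + b} : ℕ) : ℝ) := by
    exact_mod_cast h1
  linarith

lemma linear_form_bounds {m a b A t : ℕ} (hm : 0 < m) (haA : a ≤ A) (hb : 0 < b) (hbA : b ≤ A)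
    (ht : t < 64 * m ^ 2 * A) : 0 < a * t + b ∧ a * t + b ≤ (12 * m * A) ^ 2 := by
  refine ⟨by positivity, ?_⟩
  have h1 : a * t ≤ A * (64 * m ^ 2 * A) := Nat.mul_le_mul haA ht.le
  have h2 : A ≤ m ^ 2 * A ^ 2 := by
    have hA : 0 < A := by omega
    have : 0 < m ^ 2 := by positivity
    nlinarith
  nlinarith

/-- Among `64 m² A` consecutive values of `m` linear forms with coefficients at most `A`, some
value is squarefree away from small primes and from the primes dividing the leading coefficient. -/
lemma exists_sqfree_values {ι : Type*} (s : Finset ι) {m A : ℕ} (hs : #s ≤ m)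
    (hm : 0 < m) (hA : 0 < A) (a b : ι → ℕ) (ha : ∀ k ∈ s, a k ≤ A)
    (hb : ∀ k ∈ s, 0 < b k ∧ b k ≤ A) :
    ∃ t < 64 * m ^ 2 * A, ∀ k ∈ s, ∀ l, 8 * m < l → l.Coprime (a k) →
      ¬ l ^ 2 ∣ a k * t + b k := by
  classical
  by_contra! hcon
  set X := 64 * m ^ 2 * A with hX
  have h1 : range X ⊆ s.biUnion fun k =>
      {t ∈ range X | ∃ l, 8 * m < l ∧ l.Coprime (a k) ∧ l ^ 2 ∣ a k * t + b k} := by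
    intro t ht
    obtain ⟨k, hk, l, h⟩ := hcon t (mem_range.1 ht)
    exact mem_biUnion.2 ⟨k, hk, mem_filter.2 ⟨ht, l, h⟩⟩
  have h2 : (X : ℝ) ≤ ∑ k ∈ s, (#{t ∈ range X | ∃ l, 8 * m < l ∧ l.Coprime (a k) ∧
      l ^ 2 ∣ a k * t + b k} : ℝ) := by
    have := (card_le_card h1).trans card_biUnion_le
    rw [card_range] at this
    exact_mod_cast this
  have h3 := h2.trans (sum_le_card_nsmul s _ _ fun k hk => card_sq_dvd_le (X := X)
    (Z := 12 * m * A) (z := 8 * m) (by positivity) fun t ht =>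
      linear_form_bounds hm (ha k hk) (hb k hk).1 (hb k hk).2 ht)
  have hm' : (0 : ℝ) < m := by exact_mod_cast hm
  have hA' : (0 : ℝ) < A := by exact_mod_cast hA
  have hs' : (#s : ℝ) ≤ m := by exact_mod_cast hs
  rw [nsmul_eq_mul] at h3
  have h4 : (#s : ℝ) * ((X : ℝ) / ((8 * m : ℕ) : ℝ) + ((12 * m * A : ℕ) : ℝ)) ≤
      m * (8 * m * A + 12 * m * A) := by
    gcongr
    · rw [hX]; push_cast; rw [div_le_iff₀ (by positivity)]; nlinarith
    · push_cast; rfl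
  have h5 : (X : ℝ) = 64 * m ^ 2 * A := by rw [hX]; push_cast; ring
  have h6 : (0 : ℝ) < m ^ 2 * A := by positivity
  nlinarith

lemma exists_few_prime_factors {K P A V L : ℕ} (hK : 0 < K) (hP : 0 < P) (hPA : P ≤ A)
    (B : ℕ → ℕ) (hB : ∀ k < K, 0 < B k ∧ B k ≤ A) (hL : 12 * K * A ≤ 2 ^ L)
    (hV : 8 * K * (2 + L) ≤ V) :
    ∃ t, ∀ k < K, (∀ l, l.Prime → ¬ l ∣ P → 8 * K < l → ¬ l ^ 2 ∣ P * t + B k) ∧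
      2 ^ #{l ∈ (P * t + B k).primeFactors | ¬ l ∣ P} < V := by
  classical
  by_contra! hcon
  set X := 64 * K ^ 2 * A with hX
  have hA : 0 < A := by omega
  have hV0 : 0 < V := lt_of_lt_of_le (by positivity) hV
  have h1 : range X ⊆ (range K).biUnion fun k =>
      {t ∈ range X | ∃ l, 8 * K < l ∧ l.Coprime P ∧ l ^ 2 ∣ P * t + B k} ∪
      {t ∈ range X | V ≤ 2 ^ #{l ∈ (P * t + B k).primeFactors | ¬ l ∣ P}} := by
    intro t ht
    obtain ⟨k, hk, h⟩ := hcon t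
    refine mem_biUnion.2 ⟨k, mem_range.2 hk, mem_union.2 ?_⟩
    by_cases h' : ∀ l, l.Prime → ¬ l ∣ P → 8 * K < l → ¬ l ^ 2 ∣ P * t + B k
    · exact Or.inr (mem_filter.2 ⟨ht, h h'⟩)
    · push Not at h'
      obtain ⟨l, hl, h2, h3, h4⟩ := h'
      exact Or.inl (mem_filter.2 ⟨ht, l, h3, (Nat.Prime.coprime_iff_not_dvd hl).2 h2, h4⟩)
  have h2 : (X : ℝ) ≤ ∑ k ∈ range K,
      ((#{t ∈ range X | ∃ l, 8 * K < l ∧ l.Coprime P ∧ l ^ 2 ∣ P * t + B k} : ℝ) +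
      #{t ∈ range X | V ≤ 2 ^ #{l ∈ (P * t + B k).primeFactors | ¬ l ∣ P}}) := by
    have := (card_le_card h1).trans
      (card_biUnion_le.trans (sum_le_sum fun k _ => card_union_le _ _))
    rw [card_range] at this
    exact_mod_cast this
  have hZX : 12 * K * A ≤ X := by rw [hX]; nlinarith [Nat.mul_le_mul_right (K * A) hK]
  have h3 := h2.trans (sum_le_card_nsmul _ _ _ fun k hk => add_le_add
    (card_sq_dvd_le (X := X) (Z := 12 * K * A) (z := 8 * K) (by positivity) fun t ht =>
      linear_form_bounds hK hPA (hB k (mem_range.1 hk)).1 (hB k (mem_range.1 hk)).2 ht)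
    (card_two_pow_le hV0 hZX hL fun t ht =>
      linear_form_bounds hK hPA (hB k (mem_range.1 hk)).1 (hB k (mem_range.1 hk)).2 ht))
  have hK' : (0 : ℝ) < K := by exact_mod_cast hK
  have hA' : (0 : ℝ) < A := by exact_mod_cast hA
  have hV' : (8 * K * (2 + L) : ℝ) ≤ V := by exact_mod_cast hV
  rw [nsmul_eq_mul, card_range] at h3
  have h5 : (X : ℝ) = 64 * K ^ 2 * A := by rw [hX]; push_cast; ring
  have h4 : (K : ℝ) * ((X : ℝ) / ((8 * K : ℕ) : ℝ) + ((12 * K * A : ℕ) : ℝ) +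
      2 * X * (2 + L) / V) ≤ K * (8 * K * A + 12 * K * A + 16 * K * A) := by
    gcongr
    · rw [h5]; push_cast; rw [div_le_iff₀ (by positivity)]; nlinarith
    · push_cast; rfl
    · rw [h5, div_le_iff₀ (by exact_mod_cast hV0)]
      calc (2 : ℝ) * (64 * K ^ 2 * A) * (2 + L) = 16 * K * A * (8 * K * (2 + L)) := by ring
        _ ≤ _ := by gcongr
  have h6 : (0 : ℝ) < K ^ 2 * A := by positivity
  nlinarith

section Bounds

variable {g a b x y : ℕ}

lemma le_two_pow_mono (hg : 2 ≤ g) (hx : x ≤ 2 ^ g ^ a) (hab : a ≤ b) : x ≤ 2 ^ g ^ b :=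
  hx.trans (Nat.pow_le_pow_right (by norm_num) (Nat.pow_le_pow_right (by omega) hab))

lemma mul_le_two_pow (hg : 2 ≤ g) (hx : x ≤ 2 ^ g ^ a) (hy : y ≤ 2 ^ g ^ a) :
    x * y ≤ 2 ^ g ^ (a + 1) := by
  calc x * y ≤ 2 ^ g ^ a * 2 ^ g ^ a := Nat.mul_le_mul hx hy
    _ = 2 ^ (g ^ a * 2) := by rw [← pow_add]; congr 1; ring
    _ ≤ _ := Nat.pow_le_pow_right (by norm_num) (by rw [pow_succ]; gcongr)

lemma add_le_two_pow (hg : 2 ≤ g) (hx : x ≤ 2 ^ g ^ a) (hy : y ≤ 2 ^ g ^ a) :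
    x + y ≤ 2 ^ g ^ (a + 1) := by
  have h1 : 2 ^ 1 ≤ 2 ^ g ^ a :=
    Nat.pow_le_pow_right (by norm_num) (Nat.one_le_pow _ _ (by omega))
  have := mul_le_two_pow hg (a := a) (x := 2) (y := 2 ^ g ^ a) h1 le_rfl
  omega

lemma prod_le_two_pow {ι : Type*} (s : Finset ι) (f : ι → ℕ) (hs : #s ≤ g ^ b)
    (hf : ∀ i ∈ s, f i ≤ 2 ^ g ^ a) : ∏ i ∈ s, f i ≤ 2 ^ g ^ (a + b) := by
  calc ∏ i ∈ s, f i ≤ ∏ _i ∈ s, 2 ^ g ^ a := prod_le_prod' hf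
    _ = 2 ^ (g ^ a * #s) := by rw [prod_const, ← pow_mul]
    _ ≤ _ := Nat.pow_le_pow_right (by norm_num) (by rw [pow_add]; gcongr)

lemma le_two_pow_of_le (hx : x ≤ g) : x ≤ 2 ^ g ^ 1 := by
  rw [pow_one]; exact hx.trans Nat.lt_two_pow_self.le

end Bounds

/-- For a rapidly growing sequence, distinct chords of its graph have distinct slopes. -/
lemma chord_slopes_ne {K : ℕ} {w : ℕ → ℕ} (hw : ∀ i j, i < j → j < K → (K + 1) * w i < w j)
    {i j k l : ℕ} (hij : i < j) (hj : j < K) (hkl : k < l) (hl : l < K) (hne : (i, j) ≠ (k, l)) :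
    ((w j : ℤ) - w i) * (l - k) ≠ ((w l : ℤ) - w k) * (j - i) := by
  have key : ∀ i j k l, i < j → k < l → l < K → j < l →
      ((w j : ℤ) - w i) * (l - k) < ((w l : ℤ) - w k) * (j - i) := by
    intro i j k l hij hkl hl hjl
    have h1 : ((K : ℤ) + 1) * w j < w l := by exact_mod_cast hw j l hjl hl
    have h2 : ((K : ℤ) + 1) * w k < w l := by exact_mod_cast hw k l hkl hl
    have h3 : (0 : ℤ) ≤ w i := by positivity
    have h4 : (w j : ℤ) - w i ≤ w j := by linarith
    have h5 : (1 : ℤ) ≤ j - i := by omega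
    have h6 : (l : ℤ) - k ≤ K := by omega
    have h7 : (0 : ℤ) ≤ l - k := by omega
    have h8 : (0 : ℤ) ≤ w j := by positivity
    have h9 : (0 : ℤ) ≤ w k := by positivity
    have h10 : (w j : ℤ) * K < w l - w k := by
      rcases le_total (w j : ℤ) (w k) with h | h <;> nlinarith
    calc ((w j : ℤ) - w i) * (l - k) ≤ w j * (l - k) := by gcongr
      _ ≤ w j * K := by gcongr
      _ < w l - w k := h10
      _ = (w l - w k) * 1 := by ring
      _ ≤ _ := by gcongr; nlinarith
  rcases lt_trichotomy j l with h | rfl | h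
  · exact (key i j k l hij hkl hl h).ne
  · rcases lt_trichotomy i k with h | rfl | h
    · have := key i k k j h hkl hl hkl
      intro h'; nlinarith
    · exact absurd rfl hne
    · have := key k i i j h hij hl hij
      intro h'; nlinarith
  · exact (key k l i j hkl hij hj h).ne'

lemma exists_growing_residues {K M : ℕ} (hK : 0 < K) (Q : Finset ℕ) (hQ : ∀ q ∈ Q, q.Prime)
    (r : ℕ → ℕ → ℕ) :
    ∃ w : ℕ → ℕ, (∀ i, ∀ q ∈ Q, w i ≡ r q i [MOD q ^ M]) ∧
      (∀ i, w i ≤ (∏ q ∈ Q, q ^ M) * ((4 * K) ^ i + 1)) ∧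
      (∀ i, 0 < w i) ∧ ∀ i j, i < j → (K + 1) * w i < w j := by
  choose w' hw' hmod using fun i => exists_modEq_of_primes Q hQ (fun _ => M) (fun q => r q i)
  set G := ∏ q ∈ Q, q ^ M with hG
  have hG0 : 0 < G := prod_pos fun q hq => pow_pos (hQ q hq).pos _
  refine ⟨fun i => w' i + G * (4 * K) ^ i, fun i q hq => ?_, fun i => ?_, fun i => by positivity,
    fun i j hij => ?_⟩
  · have h1 : q ^ M ∣ G * (4 * K) ^ i := (dvd_prod_of_mem (fun q => q ^ M) hq).mul_right _
    simpa using (hmod i q hq).add (Nat.modEq_zero_iff_dvd.2 h1)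
  · have := hw' i
    simp only [mul_add, mul_one]
    omega
  · have h1 : (4 * K) ^ (i + 1) ≤ (4 * K) ^ j := Nat.pow_le_pow_right (by omega) hij
    have h2 : 1 ≤ (4 * K) ^ i := Nat.one_le_pow _ _ (by omega)
    have h3 := hw' i
    set T := (4 * K) ^ i with hT
    have h4 : (K + 1) * (T + 1) ≤ 4 * K * T := by nlinarith
    calc (K + 1) * (w' i + G * T) < (K + 1) * (G + G * T) := by gcongr
      _ = G * ((K + 1) * (T + 1)) := by ring
      _ ≤ G * (4 * K * T) := by gcongr
      _ ≤ G * (4 * K) ^ j := by gcongr; rw [mul_comm]; exact h1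
      _ ≤ _ := Nat.le_add_left _ _

lemma exists_separating_parameter {K g G : ℕ} (hK : 0 < K) (hKg : K ≤ g) (hg : 4 ≤ g)
    (Q : Finset ℕ) (hQ : ∀ l, l.Prime → l ∉ Q → K ^ 2 < l)
    (hGQ : ∀ l, l.Prime → l ∉ Q → ¬ l ∣ G) (hG : G ≤ 2 ^ g ^ 1) (w : ℕ → ℕ)
    (hw : ∀ i j, i < j → (K + 1) * w i < w j) (hwb : ∀ i < K, w i ≤ 2 ^ g ^ 4) :
    ∃ y : ℕ, y ≤ 2 ^ g ^ 18 ∧ ∀ l, l.Prime → l ∉ Q →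
      (∀ i j, i < j → j < K → ¬ (l : ℤ) ^ 2 ∣ ((w j : ℤ) - w i) + G * (j - i) * y) ∧
      ∀ i j k m, i < j → j < K → k < m → m < K →
        (l : ℤ) ∣ ((w j : ℤ) - w i) + G * (j - i) * y →
        (l : ℤ) ∣ ((w m : ℤ) - w k) + G * (m - k) * y → (i, j) = (k, m) := by
  classical
  have hg2 : 2 ≤ g := by omega
  have hmono : ∀ i j, i < j → w i < w j := fun i j h => by nlinarith [hw i j h]
  set pairs := (range K ×ˢ range K).filter fun p => p.1 < p.2 with hpairs
  have mem_pairs : ∀ p, p ∈ pairs ↔ p.1 < p.2 ∧ p.2 < K := by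
    intro p; simp only [hpairs, mem_filter, mem_product, mem_range]; omega
  have card_pairs : #pairs ≤ K ^ 2 := by
    refine (card_filter_le _ _).trans ?_
    rw [card_product, card_range, sq]
  set quads := (pairs ×ˢ pairs).filter fun u => u.1 ≠ u.2 with hquads
  set res : (ℕ × ℕ) × (ℕ × ℕ) → ℤ := fun u =>
    ((w u.1.2 : ℤ) - w u.1.1) * (u.2.2 - u.2.1) - ((w u.2.2 : ℤ) - w u.2.1) * (u.1.2 - u.1.1)
    with hres
  set B := (∏ q ∈ firstPrimes (8 * K ^ 2), q) * ∏ u ∈ quads, (res u).natAbs with hB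
  have hB0 : B ≠ 0 := by
    refine mul_ne_zero (prod_ne_zero_iff.2 fun q hq => (prime_of_mem_firstPrimes hq).ne_zero)
      (prod_ne_zero_iff.2 fun u hu => ?_)
    simp only [hquads, mem_filter, mem_product, mem_pairs] at hu
    obtain ⟨⟨⟨h1, h2⟩, h3, h4⟩, h5⟩ := hu
    rw [Int.natAbs_ne_zero]
    exact sub_ne_zero.2 (chord_slopes_ne (fun i j h _ => hw i j h) h1 h2 h3 h4 (by simpa using h5))
  set S := B.primeFactors \ Q with hS
  have hSp : ∀ l ∈ S, l.Prime := fun l hl => Nat.prime_of_mem_primeFactors (mem_sdiff.1 hl).1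
  have hSQ : ∀ l ∈ S, l ∉ Q := fun l hl => (mem_sdiff.1 hl).2
  have hcoef : ∀ l, l.Prime → l ∉ Q → ∀ p ∈ pairs, ¬ l ∣ G * (p.2 - p.1) := by
    intro l hl hlQ p hp h
    rw [mem_pairs] at hp
    rcases hl.dvd_mul.1 h with h | h
    · exact hGQ l hl hlQ h
    · have h1 := Nat.le_of_dvd (by omega) h
      have h2 := hQ l hl hlQ
      have h3 := Nat.le_self_pow two_ne_zero K
      omega
  have hav : ∀ l, ∃ y : ℕ, l ∈ S → ∀ p ∈ pairs,
      ¬ (l : ℤ) ∣ ((G * (p.2 - p.1) : ℕ) : ℤ) * y + ((w p.2 : ℤ) - w p.1) := by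
    intro l
    by_cases hl : l ∈ S
    · obtain ⟨y, hy⟩ := exists_forall_not_dvd pairs
        (fun p => ((G * (p.2 - p.1) : ℕ) : ℤ)) (fun p => (w p.2 : ℤ) - w p.1) (hSp l hl)
        (card_pairs.trans_lt (hQ l (hSp l hl) (hSQ l hl))) fun p hp => by
          rw [Int.natCast_dvd_natCast]; exact hcoef l (hSp l hl) (hSQ l hl) p hp
      exact ⟨y, fun _ => hy⟩
    · exact ⟨0, fun h => absurd h hl⟩
  choose r hr using hav
  obtain ⟨y₀, hy₀, hmod⟩ := exists_modEq_of_primes S hSp (fun _ => 1) r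
  simp only [pow_one] at hy₀ hmod
  set R := ∏ l ∈ S, l with hR
  have hR0 : 0 < R := prod_pos fun l hl => (hSp l hl).pos
  have hwd : ∀ p ∈ pairs, w p.1 < w p.2 := fun p hp => hmono _ _ ((mem_pairs p).1 hp).1
  -- size bounds
  have hKb : K ≤ 2 ^ g ^ 1 := le_two_pow_of_le hKg
  have hRb : R ≤ 2 ^ g ^ 11 := by
    have h1 : R ≤ B := by
      refine Nat.le_of_dvd (Nat.pos_of_ne_zero hB0)
        ((prod_dvd_prod_of_subset _ _ _ sdiff_subset).trans (Nat.prod_primeFactors_dvd B))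
    have h2 : ∏ q ∈ firstPrimes (8 * K ^ 2), q ≤ 2 ^ g ^ 10 := by
      refine (prod_firstPrimes_le _).trans (Nat.pow_le_pow_right (by norm_num) ?_)
      calc 8 * K ^ 2 * (8 * K ^ 2) = 4 ^ 3 * K ^ 4 := by ring
        _ ≤ g ^ 3 * g ^ 4 := by gcongr
        _ = g ^ 7 := by ring
        _ ≤ g ^ 10 := Nat.pow_le_pow_right (by omega) (by norm_num)
    have h3 : ∏ u ∈ quads, (res u).natAbs ≤ 2 ^ g ^ (6 + 4) := by
      refine prod_le_two_pow _ _ ?_ fun u hu => ?_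
      · calc #quads ≤ #(pairs ×ˢ pairs) := card_filter_le _ _
          _ = #pairs * #pairs := card_product _ _
          _ ≤ K ^ 2 * K ^ 2 := Nat.mul_le_mul card_pairs card_pairs
          _ = K ^ 4 := by ring
          _ ≤ g ^ 4 := by gcongr
      · simp only [hquads, mem_filter, mem_product, mem_pairs] at hu
        obtain ⟨⟨⟨h1, h2⟩, h3, h4⟩, -⟩ := hu
        have hb : ∀ a b : ℕ × ℕ, a.1 < a.2 → a.2 < K → b.1 < b.2 → b.2 < K →
            ((w a.2 : ℤ) - w a.1) * (b.2 - b.1) ≤ ((2 ^ g ^ 5 : ℕ) : ℤ) := by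
          intro a b ha ha' hb hb'
          have h6 : w a.2 * K ≤ 2 ^ g ^ 5 :=
            mul_le_two_pow hg2 (hwb _ ha') (le_two_pow_mono hg2 hKb (by norm_num))
          have h7 : (0 : ℤ) ≤ w a.1 := by positivity
          have h8 : (0 : ℤ) ≤ (b.2 : ℤ) - b.1 := by omega
          calc ((w a.2 : ℤ) - w a.1) * (b.2 - b.1) ≤ w a.2 * K := by
                gcongr <;> omega
            _ ≤ _ := by exact_mod_cast h6
        have hb0 : ∀ a b : ℕ × ℕ, a.1 < a.2 → b.1 < b.2 →
            0 ≤ ((w a.2 : ℤ) - w a.1) * (b.2 - b.1) := by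
          intro a b ha hb
          have := hmono _ _ ha
          exact mul_nonneg (by omega) (by omega)
        have h9 : 2 ^ g ^ 5 ≤ 2 ^ g ^ 6 := le_two_pow_mono hg2 le_rfl (by norm_num)
        have h10 := hb u.1 u.2 h1 h2 h3 h4
        have h11 := hb u.2 u.1 h3 h4 h1 h2
        have h12 := hb0 u.1 u.2 h1 h3
        have h13 := hb0 u.2 u.1 h3 h1
        simp only [hres]
        omega
    exact h1.trans (mul_le_two_pow hg2 h2 h3)
  have hGKR : G * K * R ≤ 2 ^ g ^ 12 :=
    mul_le_two_pow hg2 (le_two_pow_mono hg2 (mul_le_two_pow hg2 hG hKb) (by norm_num)) hRb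
  obtain ⟨t, ht, hsq⟩ := exists_sqfree_values pairs (A := 2 ^ g ^ 13) card_pairs (by positivity)
    (by positivity) (fun p => G * (p.2 - p.1) * R)
    (fun p => (w p.2 - w p.1) + G * (p.2 - p.1) * y₀)
    (fun p hp => by
      rw [mem_pairs] at hp
      refine le_trans ?_ (le_two_pow_mono hg2 hGKR (by norm_num))
      gcongr; omega)
    (fun p hp => by
      have h1 := hwd p hp
      rw [mem_pairs] at hp
      refine ⟨by omega, add_le_two_pow hg2
        (le_two_pow_mono hg2 ((Nat.sub_le _ _).trans (hwb _ hp.2)) (by norm_num)) (le_trans ?_ hGKR)⟩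
      gcongr; omega)
  have hcast : ∀ p ∈ pairs, ((G * (p.2 - p.1) * R * t +
      ((w p.2 - w p.1) + G * (p.2 - p.1) * y₀) : ℕ) : ℤ) =
      ((w p.2 : ℤ) - w p.1) + G * (p.2 - p.1) * ((y₀ + R * t : ℕ) : ℤ) := by
    intro p hp
    have h1 := hwd p hp
    rw [mem_pairs] at hp
    push_cast [Nat.cast_sub h1.le, Nat.cast_sub hp.1.le]
    ring
  have hnd : ∀ l ∈ S, ∀ p ∈ pairs,
      ¬ (l : ℤ) ∣ ((w p.2 : ℤ) - w p.1) + G * (p.2 - p.1) * ((y₀ + R * t : ℕ) : ℤ) := by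
    intro l hl p hp hdvd
    refine hr l hl p hp ?_
    have h1 : (l : ℤ) ∣ R := Int.natCast_dvd_natCast.2 (dvd_prod_of_mem (fun l => l) hl)
    have h2 := Nat.modEq_iff_dvd.1 (hmod l hl)
    rw [mem_pairs] at hp
    have h3 := dvd_add hdvd (dvd_sub (h2.mul_left ((G : ℤ) * (p.2 - p.1)))
      (h1.mul_left ((G : ℤ) * (p.2 - p.1) * t)))
    have h4 : ((G * (p.2 - p.1) : ℕ) : ℤ) = G * ((p.2 : ℤ) - p.1) := by
      push_cast [Nat.cast_sub hp.1.le]; rfl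
    rw [h4]
    obtain ⟨c, hc⟩ := h3
    exact ⟨c, by rw [← hc]; push_cast; ring⟩
  refine ⟨y₀ + R * t, ?_, fun l hl hlQ => ⟨fun i j hij hj hdvd => ?_,
    fun i j k m hij hj hkm hm h1 h2 => ?_⟩⟩
  · have h1 : 64 * (K ^ 2) ^ 2 * 2 ^ g ^ 13 ≤ 2 ^ g ^ 16 := by
      have h64 : 64 ≤ 2 ^ g ^ 3 := by
        calc 64 = 2 ^ 6 := by norm_num
          _ ≤ 2 ^ 4 ^ 3 := Nat.pow_le_pow_right (by norm_num) (by norm_num)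
          _ ≤ _ := Nat.pow_le_pow_right (by norm_num) (by gcongr)
      have hK4 : (K ^ 2) ^ 2 ≤ 2 ^ g ^ 3 := by
        have h2 : K ^ 2 ≤ 2 ^ g ^ 2 := by rw [sq]; exact mul_le_two_pow hg2 hKb hKb
        rw [sq (K ^ 2)]; exact mul_le_two_pow hg2 h2 h2
      refine le_two_pow_mono hg2 (mul_le_two_pow hg2 (le_two_pow_mono hg2
        (mul_le_two_pow hg2 h64 hK4) (b := 13) (by norm_num)) le_rfl) (by norm_num)
    exact add_le_two_pow hg2 (le_two_pow_mono hg2 (hy₀.le.trans hRb) (by norm_num))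
      (mul_le_two_pow hg2 (le_two_pow_mono hg2 hRb (b := 16) (by norm_num)) (ht.le.trans h1))
  · have hp : (i, j) ∈ pairs := (mem_pairs _).2 ⟨hij, hj⟩
    by_cases hlS : l ∈ S
    · exact hnd l hlS _ hp ((dvd_pow_self _ two_ne_zero).trans hdvd)
    · have hlB : ¬ l ∣ B := fun h =>
        hlS (mem_sdiff.2 ⟨Nat.mem_primeFactors.2 ⟨hl, h, hB0⟩, hlQ⟩)
      refine hsq (i, j) hp l ?_ ?_ ?_
      · refine lt_of_notMem_firstPrimes hl fun h => hlB ?_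
        exact (dvd_prod_of_mem (fun l => l) h).mul_right _
      · refine (Nat.Prime.coprime_iff_not_dvd hl).2 fun h => ?_
        rcases hl.dvd_mul.1 h with h | h
        · exact hcoef l hl hlQ _ hp h
        · obtain ⟨q, hq, hlq⟩ := (hl.prime.dvd_finsetProd_iff _).1 h
          rw [(Nat.prime_dvd_prime_iff_eq hl (hSp q hq)).1 hlq] at hlS
          exact hlS hq
      · rw [← Int.natCast_dvd_natCast, hcast _ hp]
        simpa using hdvd
  · by_contra hne
    have hu : ((i, j), (k, m)) ∈ quads := by
      simp only [hquads, mem_filter, mem_product, mem_pairs]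
      exact ⟨⟨⟨hij, hj⟩, hkm, hm⟩, hne⟩
    have h3 : (l : ℤ) ∣ res ((i, j), (k, m)) := by
      obtain ⟨c, hc⟩ := dvd_sub (h1.mul_right ((m : ℤ) - k)) (h2.mul_right ((j : ℤ) - i))
      exact ⟨c, by rw [← hc]; simp only [hres]; ring⟩
    have h4 : l ∣ B := (Int.natCast_dvd.1 h3).trans
      ((dvd_prod_of_mem (fun u => (res u).natAbs) hu).mul_left _)
    exact hnd l (mem_sdiff.2 ⟨Nat.mem_primeFactors.2 ⟨hl, h4, hB0⟩, hlQ⟩) (i, j)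
      ((mem_pairs _).2 ⟨hij, hj⟩) h1

lemma pow_dvd_sub_exact {q a b : ℕ} {c d : ℤ} (hq : q.Prime) (hc : ¬ (q : ℤ) ∣ c)
    (hd : ¬ (q : ℤ) ∣ d) (hcd : a = b → ¬ (q : ℤ) ∣ d - c) :
    (q : ℤ) ^ min a b ∣ q ^ b * d - q ^ a * c ∧ ¬ (q : ℤ) ^ (min a b + 1) ∣ q ^ b * d - q ^ a * c := by
  have hq0 : (q : ℤ) ≠ 0 := by exact_mod_cast hq.ne_zero
  have hcancel : ∀ (m : ℕ) (z : ℤ), (q : ℤ) ^ (m + 1) ∣ q ^ m * z → (q : ℤ) ∣ z := by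
    intro m z h
    rw [pow_succ] at h
    exact (mul_dvd_mul_iff_left (pow_ne_zero m hq0)).1 h
  rcases lt_trichotomy a b with h | rfl | h
  · obtain ⟨k, rfl⟩ := Nat.exists_eq_add_of_lt h
    have e : (q : ℤ) ^ (a + k + 1) * d - q ^ a * c = q ^ a * (q * (q ^ k * d) - c) := by ring
    rw [min_eq_left h.le, e]
    exact ⟨dvd_mul_right _ _, fun h' => hc ((dvd_sub_right (dvd_mul_right _ _)).1 (hcancel _ _ h'))⟩
  · have e : (q : ℤ) ^ a * d - q ^ a * c = q ^ a * (d - c) := by ring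
    rw [min_self, e]
    exact ⟨dvd_mul_right _ _, fun h' => hcd rfl (hcancel _ _ h')⟩
  · obtain ⟨k, rfl⟩ := Nat.exists_eq_add_of_lt h
    have e : (q : ℤ) ^ b * d - q ^ (b + k + 1) * c = q ^ b * (d - q * (q ^ k * c)) := by ring
    rw [min_eq_right h.le, e]
    exact ⟨dvd_mul_right _ _, fun h' => hd ((dvd_sub_left (dvd_mul_right _ _)).1 (hcancel _ _ h'))⟩

lemma exists_shifts {K M g : ℕ} (hK : 0 < K) (hKg : K ≤ g) (hg : 4 ≤ g) (Q : Finset ℕ)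
    (hQp : ∀ q ∈ Q, q.Prime) (hQ : ∀ l, l.Prime → l ∉ Q → K ^ 2 < l)
    (hG : ∏ q ∈ Q, q ^ M ≤ 2 ^ g ^ 1) (e : ℕ → ℕ → ℕ) (heM : ∀ q ∈ Q, ∀ i < K, e q i < M)
    (he : ∀ q ∈ Q, q ≤ K → ∀ i j, i < j → j < K → e q i ≠ e q j) :
    ∃ h : ℕ → ℕ, (∀ i < K, 0 < h i ∧ h i ≤ 2 ^ g ^ 20) ∧
      (∀ i j, i < j → j < K → h i < h j) ∧
      (∀ q ∈ Q, ∀ i < K, q ^ e q i ∣ h i ∧ ¬ q ^ (e q i + 1) ∣ h i) ∧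
      (∀ q ∈ Q, ∀ i j, i < j → j < K → q ^ min (e q i) (e q j) ∣ h j - h i ∧
        ¬ q ^ (min (e q i) (e q j) + 1) ∣ h j - h i) ∧
      ∀ l, l.Prime → l ∉ Q → (∀ i j, i < j → j < K → ¬ l ^ 2 ∣ h j - h i) ∧
        ∀ i j k m, i < j → j < K → k < m → m < K → l ∣ h j - h i → l ∣ h m - h k →
          i = k ∧ j = m := by
  have hg2 : 2 ≤ g := by omega
  obtain ⟨w, hwr, hwb, hw0, hw⟩ := exists_growing_residues hK Q hQp (M := M)
    (fun q i => q ^ e q i * if K < q then i + 1 else 1)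
  set G := ∏ q ∈ Q, q ^ M with hGdef
  have hKb : K ≤ 2 ^ g ^ 1 := le_two_pow_of_le hKg
  have hwK : ∀ i < K, w i ≤ 2 ^ g ^ 4 := by
    intro i hi
    have h1 : 4 * K ≤ 2 ^ g ^ 2 := mul_le_two_pow hg2 (le_two_pow_of_le hg) hKb
    have h2 : (4 * K) ^ i + 1 ≤ 2 ^ g ^ (2 + 1) := by
      calc (4 * K) ^ i + 1 ≤ (4 * K) ^ (i + 1) := by
            rw [pow_succ]; nlinarith [Nat.one_le_pow i (4 * K) (by omega)]
        _ ≤ (4 * K) ^ g := Nat.pow_le_pow_right (by omega) (by omega)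
        _ ≤ (2 ^ g ^ 2) ^ g := Nat.pow_le_pow_left h1 _
        _ = _ := by rw [← pow_mul]; ring
    exact (hwb i).trans (mul_le_two_pow hg2 (le_two_pow_mono hg2 hG (by norm_num)) h2)
  obtain ⟨y, hy, hsep⟩ := exists_separating_parameter hK hKg hg Q hQ
    (fun l hl hlQ h => by
      obtain ⟨q, hq, hlq⟩ := (hl.prime.dvd_finsetProd_iff _).1 h
      rw [(Nat.prime_dvd_prime_iff_eq hl (hQp q hq)).1 (hl.dvd_of_dvd_pow hlq)] at hlQ
      exact hlQ hq) hG w hw hwK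
  set h : ℕ → ℕ := fun i => w i + G * i * y with hh
  have hmono : ∀ i j, i < j → h i < h j := by
    intro i j hij
    have h1 : w i < w j := by nlinarith [hw i j hij]
    have h2 : G * i * y ≤ G * j * y := by gcongr
    simp only [hh]; omega
  have hcast : ∀ i j, i < j → ((h j - h i : ℕ) : ℤ) = ((w j : ℤ) - w i) + G * (j - i) * y := by
    intro i j hij
    rw [Nat.cast_sub (hmono i j hij).le]
    simp only [hh]; push_cast; ring
  have hmod : ∀ q ∈ Q, ∀ i, h i ≡ q ^ e q i * (if K < q then i + 1 else 1) [MOD q ^ M] := by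
    intro q hq i
    have h1 : q ^ M ∣ G * i * y :=
      ((dvd_prod_of_mem (fun q => q ^ M) hq).mul_right _).mul_right _
    simpa using (hwr i q hq).add (Nat.modEq_zero_iff_dvd.2 h1)
  have hcop : ∀ q ∈ Q, ∀ i < K, ¬ q ∣ (if K < q then i + 1 else 1) := by
    intro q hq i hi hdvd
    split_ifs at hdvd with h1
    · exact absurd (Nat.le_of_dvd (by omega) hdvd) (by omega)
    · exact (hQp q hq).one_lt.ne' (Nat.dvd_one.1 hdvd)
  have hle : ∀ q ∈ Q, ∀ i < K, q ^ (e q i + 1) ∣ q ^ M := fun q hq i hi =>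
    pow_dvd_pow _ (heM q hq i hi)
  refine ⟨h, fun i hi => ⟨Nat.add_pos_left (hw0 i) _, ?_⟩, fun i j hij _ => hmono i j hij,
    fun q hq i hi => ⟨?_, fun hd => ?_⟩, fun q hq i j hij hj => ?_,
    fun l hl hlQ => ⟨fun i j hij hj hd => ?_, fun i j k m hij hj hkm hm h1 h2 => ?_⟩⟩
  · refine add_le_two_pow hg2 (le_two_pow_mono hg2 (hwK i hi) (by norm_num))
      (mul_le_two_pow hg2 (le_two_pow_mono hg2 (mul_le_two_pow hg2 hG ?_) (by norm_num)) hy)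
    exact hi.le.trans hKb
  · exact ((hmod q hq i).dvd_iff ((Nat.pow_dvd_pow _ (Nat.le_succ _)).trans (hle q hq i hi))).2
      (dvd_mul_right _ _)
  · have h1 := ((hmod q hq i).dvd_iff (hle q hq i hi)).1 hd
    rw [pow_succ] at h1
    exact hcop q hq i hi (Nat.dvd_of_mul_dvd_mul_left (pow_pos (hQp q hq).pos _) h1)
  · have hi := hij.trans hj
    have key := pow_dvd_sub_exact (a := e q i) (b := e q j) (hQp q hq)
      (c := ((if K < q then i + 1 else 1 : ℕ) : ℤ)) (d := ((if K < q then j + 1 else 1 : ℕ) : ℤ))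
      (mt Int.natCast_dvd_natCast.1 (hcop q hq i hi))
      (mt Int.natCast_dvd_natCast.1 (hcop q hq j hj)) (fun hee hd => by
        by_cases hqK : K < q
        · simp only [hqK, if_true] at hd
          have h3 : (((j + 1 : ℕ) : ℤ) - ((i + 1 : ℕ) : ℤ)) = ((j - i : ℕ) : ℤ) := by omega
          rw [h3, Int.natCast_dvd_natCast] at hd
          exact absurd (Nat.le_of_dvd (by omega) hd) (by omega)
        · exact he q hq (by omega) i j hij hj hee)
    have hz : (q : ℤ) ^ M ∣ ((h j - h i : ℕ) : ℤ) - (q ^ e q j * (if K < q then j + 1 else 1 : ℕ) -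
        q ^ e q i * (if K < q then i + 1 else 1 : ℕ)) := by
      have h1 := (Nat.modEq_iff_dvd.1 (hmod q hq i))
      have h2 := (Nat.modEq_iff_dvd.1 (hmod q hq j))
      obtain ⟨c, hc⟩ := dvd_sub h1 h2
      refine ⟨c, ?_⟩
      rw [Nat.cast_sub (hmono i j hij).le]
      push_cast at hc ⊢
      linear_combination hc
    have hM : min (e q i) (e q j) + 1 ≤ M := by have := heM q hq i hi; omega
    have hiff : ∀ n, n ≤ M → (q ^ n ∣ h j - h i ↔ (q : ℤ) ^ n ∣
        q ^ e q j * (if K < q then j + 1 else 1 : ℕ) -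
        q ^ e q i * (if K < q then i + 1 else 1 : ℕ)) := by
      intro n hn
      rw [← Int.natCast_dvd_natCast, Nat.cast_pow]
      exact dvd_iff_dvd_of_dvd_sub ((pow_dvd_pow _ hn).trans hz)
    rw [hiff _ (by omega), hiff _ hM]
    exact key
  · refine (hsep l hl hlQ).1 i j hij hj ?_
    rw [← hcast i j hij]; exact_mod_cast hd
  · have := (hsep l hl hlQ).2 i j k m hij hj hkm hm
      (by rw [← hcast i j hij]; exact_mod_cast h1) (by rw [← hcast k m hkm]; exact_mod_cast h2)
    simpa using this

lemma exists_card_fiber_eq (F : Finset ℕ) (d : ℕ → ℕ) (K : ℕ) (h : ∑ k ∈ range K, d k ≤ #F) :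
    ∃ f : ℕ → ℕ, ∀ k < K, #{l ∈ F | f l = k} = d k := by
  induction K generalizing F with
  | zero => exact ⟨id, fun k hk => absurd hk (Nat.not_lt_zero k)⟩
  | succ K ih =>
    rw [sum_range_succ] at h
    obtain ⟨T, hTF, hT⟩ := exists_subset_card_eq (s := F) (n := d K) (by omega)
    obtain ⟨f, hf⟩ := ih (F \ T) (by rw [card_sdiff_of_subset hTF]; omega)
    refine ⟨fun l => if l ∈ T then K else if f l = K then K + 1 else f l, fun k hk => ?_⟩
    rcases Nat.lt_succ_iff_lt_or_eq.1 hk with hk | rfl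
    · rw [← hf k hk]
      congr 1
      ext l
      simp only [mem_filter, mem_sdiff]
      split_ifs <;> grind
    · rw [← hT]
      congr 1
      ext l
      simp only [mem_filter]
      split_ifs with h1 h2
      · simp [h1, hTF h1]
      · simp [h1]
      · simp [h1, h2]

section Residues

variable {K l : ℕ} {h : ℕ → ℕ}

lemma exists_residue_of_pair (hl : l.Prime) (hl2 : 2 < l)
    (hmono : ∀ i j, i < j → j < K → h i < h j)
    (hsq : ∀ i j, i < j → j < K → ¬ l ^ 2 ∣ h j - h i)
    (huniq : ∀ i j k m, i < j → j < K → k < m → m < K → l ∣ h j - h i → l ∣ h m - h k →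
      i = k ∧ j = m)
    {i j : ℕ} (hij : i < j) (hj : j < K) (hd : l ∣ h j - h i) :
    ∃ r, ∀ k < K, ¬ l ^ 2 ∣ r + h k ∧ (l ∣ r + h k ↔ k = i ∨ k = j) := by
  have hlt := hmono i j hij hj
  have hpos := pow_pos hl.pos 2
  have e1 : h j + 2 * (l ^ 2 - 1) * h i + h i = l ^ 2 * (2 * h i) + (h j - h i) := by
    zify [hlt.le, Nat.one_le_of_lt hpos]; ring
  have e2 : h j + 2 * (l ^ 2 - 1) * h i + h j = l ^ 2 * (2 * h i) + 2 * (h j - h i) := by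
    zify [hlt.le, Nat.one_le_of_lt hpos]; ring
  have hl' : l ∣ l ^ 2 * (2 * h i) := (dvd_pow_self _ two_ne_zero).mul_right _
  have hni : l ∣ h j + 2 * (l ^ 2 - 1) * h i + h i := by
    rw [e1]; exact dvd_add hl' hd
  have hnj : l ∣ h j + 2 * (l ^ 2 - 1) * h i + h j := by
    rw [e2]; exact dvd_add hl' (hd.mul_left 2)
  refine ⟨h j + 2 * (l ^ 2 - 1) * h i, fun k hk => ?_⟩
  by_cases hki : k = i
  · subst hki
    refine ⟨fun h1 => hsq k j hij hj ?_, by simpa using hni⟩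
    rw [e1] at h1
    exact (Nat.dvd_add_right (dvd_mul_right _ _)).1 h1
  by_cases hkj : k = j
  · subst hkj
    refine ⟨fun h1 => hsq i k hij hj ?_, by simpa using hnj⟩
    rw [e2] at h1
    refine Nat.Coprime.dvd_of_dvd_mul_left (k := l ^ 2) (m := 2) ?_
      ((Nat.dvd_add_right (dvd_mul_right _ _)).1 h1)
    exact ((Nat.coprime_primes hl Nat.prime_two).2 hl2.ne').pow_left 2
  have hnk : ¬ l ∣ h j + 2 * (l ^ 2 - 1) * h i + h k := by
    intro h1
    rcases lt_or_gt_of_ne hki with h2 | h2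
    · have h3 := (Nat.dvd_sub hni h1)
      rw [Nat.add_sub_add_left] at h3
      have := huniq i j k i hij hj h2 (hij.trans hj) hd h3
      omega
    · have h3 := (Nat.dvd_sub h1 hni)
      rw [Nat.add_sub_add_left] at h3
      have := huniq i j i k hij hj h2 hk hd h3
      omega
  exact ⟨fun h1 => hnk ((dvd_pow_self _ two_ne_zero).trans h1), by simp [hnk, hki, hkj]⟩

lemma exists_residue_of_index (hl : l.Prime) (hlK : K < l)
    (hD : ∀ i j, i < j → j < K → ¬ l ∣ h j - h i) (a : ℕ) :
    ∃ r, ∀ k < K, ¬ l ^ 2 ∣ r + h k ∧ (l ∣ r + h k ↔ a = k) := by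
  by_cases ha : a < K
  · have hpos := pow_pos hl.pos 2
    have e : (l ^ 2 - 1) * h a + l + h a = l ^ 2 * h a + l := by
      zify [Nat.one_le_of_lt hpos]; ring
    have hna : l ∣ (l ^ 2 - 1) * h a + l + h a := by
      rw [e]; exact dvd_add ((dvd_pow_self _ two_ne_zero).mul_right _) dvd_rfl
    refine ⟨(l ^ 2 - 1) * h a + l, fun k hk => ?_⟩
    by_cases hka : a = k
    · subst hka
      refine ⟨fun h1 => ?_, by simpa using hna⟩
      rw [e] at h1
      have h2 := Nat.le_of_dvd hl.pos ((Nat.dvd_add_right (dvd_mul_right _ _)).1 h1)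
      nlinarith [hl.one_lt]
    have hnk : ¬ l ∣ (l ^ 2 - 1) * h a + l + h k := by
      intro h1
      rcases lt_or_gt_of_ne hka with h2 | h2
      · have h3 := (Nat.dvd_sub h1 hna)
        rw [Nat.add_sub_add_left] at h3
        exact hD a k h2 hk h3
      · have h3 := (Nat.dvd_sub hna h1)
        rw [Nat.add_sub_add_left] at h3
        exact hD k a h2 ha h3
    exact ⟨fun h1 => hnk ((dvd_pow_self _ two_ne_zero).trans h1), by simp [hnk, hka]⟩
  · obtain ⟨r, hr⟩ := exists_forall_not_dvd (range K) (fun _ => 1) (fun k => (h k : ℤ)) hl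
      (by rwa [card_range]) fun k _ h1 => by
        have := Int.natCast_dvd_natCast.1 (by exact_mod_cast h1 : (l : ℤ) ∣ ((1 : ℕ) : ℤ))
        exact hl.one_lt.ne' (Nat.dvd_one.1 this)
    have hr' : ∀ k < K, ¬ l ∣ r + h k := by
      intro k hk h1
      refine hr k (mem_range.2 hk) ?_
      rw [one_mul]; exact_mod_cast h1
    refine ⟨r, fun k hk => ⟨fun h1 => hr' k hk ((dvd_pow_self _ two_ne_zero).trans h1), ?_⟩⟩
    simp only [hr' k hk, false_iff]
    omega

end Residues

lemma card_le_of_prod_le_two_pow {S : Finset ℕ} {f : ℕ → ℕ} {a : ℕ} (hS : ∀ l ∈ S, 2 ≤ f l)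
    (h : ∏ l ∈ S, f l ≤ 2 ^ a) : #S ≤ a :=
  (Nat.pow_le_pow_iff_right one_lt_two).1 ((pow_card_le_prod S f 2 hS).trans h)

open scoped Classical in
/-- Residues at finitely many further primes forcing, at every index, the same number of them to
divide the shifted value. -/
lemma exists_balanced_residues {K g k₂ : ℕ} (hKg : K ≤ g) (hg : 4 ≤ g) (Q : Finset ℕ)
    (hQ : ∀ l, l.Prime → l ∉ Q → K ^ 2 < l) (hQc : #Q ≤ g) (h : ℕ → ℕ)
    (hb : ∀ i < K, h i ≤ 2 ^ g ^ 20) (hmono : ∀ i j, i < j → j < K → h i < h j)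
    (hsep : ∀ l, l.Prime → l ∉ Q → (∀ i j, i < j → j < K → ¬ l ^ 2 ∣ h j - h i) ∧
        ∀ i j k m, i < j → j < K → k < m → m < K → l ∣ h j - h i → l ∣ h m - h k →
          i = k ∧ j = m) (hK : 2 ≤ K) (hk : k₂ = g ^ 24) :
    ∃ (L : Finset ℕ) (r : ℕ → ℕ) (c : ℕ), (∀ l ∈ L, l.Prime ∧ l ∉ Q) ∧
      (∀ l ∈ firstPrimes k₂, l ∉ Q → l ∈ L) ∧
      ∏ l ∈ L, l ≤ 2 ^ g ^ 49 ∧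
      (∀ l ∈ L, ∀ k < K, ¬ l ^ 2 ∣ r l + h k) ∧
      (∀ l, l.Prime → l ∉ Q → ∀ i j, i < j → j < K → l ∣ h j - h i → l ∈ L ∧ l ∣ r l + h i) ∧
      ∀ k < K, #{l ∈ L | l ∣ r l + h k} = c := by
  have hg2 : 2 ≤ g := by omega
  set pairs := (range K ×ˢ range K).filter fun p => p.1 < p.2 with hpairs
  have mem_pairs : ∀ p, p ∈ pairs ↔ p.1 < p.2 ∧ p.2 < K := by
    intro p; simp only [hpairs, mem_filter, mem_product, mem_range]; omega
  have card_pairs : #pairs ≤ g ^ 2 := by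
    refine (card_filter_le _ _).trans ?_
    rw [card_product, card_range, sq]; gcongr
  set D := ∏ p ∈ pairs, (h p.2 - h p.1) with hD
  have hD0 : D ≠ 0 := prod_ne_zero_iff.2 fun p hp => by
    have := (mem_pairs p).1 hp
    have := hmono _ _ this.1 this.2
    omega
  have hDb : D ≤ 2 ^ g ^ (20 + 2) := prod_le_two_pow _ _ card_pairs fun p hp =>
    (Nat.sub_le _ _).trans (hb _ ((mem_pairs p).1 hp).2)
  set LD := D.primeFactors \ Q with hLD
  have hLDp : ∀ l ∈ LD, l.Prime := fun l hl => Nat.prime_of_mem_primeFactors (mem_sdiff.1 hl).1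
  have hLDQ : ∀ l ∈ LD, l ∉ Q := fun l hl => (mem_sdiff.1 hl).2
  have hLDb : ∏ l ∈ LD, l ≤ 2 ^ g ^ 22 :=
    (Nat.le_of_dvd (Nat.pos_of_ne_zero hD0)
      ((prod_dvd_prod_of_subset _ _ _ sdiff_subset).trans (Nat.prod_primeFactors_dvd D))).trans hDb
  have hLDc : #LD ≤ g ^ 22 := card_le_of_prod_le_two_pow (fun l hl => (hLDp l hl).two_le) hLDb
  have hLDpair : ∀ l ∈ LD, ∃ i j, i < j ∧ j < K ∧ l ∣ h j - h i := by
    intro l hl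
    obtain ⟨p, hp, hlp⟩ := ((hLDp l hl).prime.dvd_finsetProd_iff _).1
      (Nat.dvd_of_mem_primeFactors (mem_sdiff.1 hl).1)
    exact ⟨p.1, p.2, ((mem_pairs p).1 hp).1, ((mem_pairs p).1 hp).2, hlp⟩
  have hnLD : ∀ l, l.Prime → l ∉ Q → l ∉ LD → ∀ i j, i < j → j < K → ¬ l ∣ h j - h i := by
    intro l hl hlQ hlD i j hij hj hd
    refine hlD (mem_sdiff.2 ⟨Nat.mem_primeFactors.2 ⟨hl, hd.trans ?_, hD0⟩, hlQ⟩)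
    exact dvd_prod_of_mem (fun p : ℕ × ℕ => h p.2 - h p.1) ((mem_pairs (i, j)).2 ⟨hij, hj⟩)
  have hgt : ∀ l, l.Prime → l ∉ Q → K < l ∧ 2 < l := by
    intro l hl hlQ
    have h1 := hQ l hl hlQ
    have h2 := Nat.le_self_pow two_ne_zero K
    have h3 : 2 ^ 2 ≤ K ^ 2 := Nat.pow_le_pow_left hK 2
    omega
  -- residues for the primes dividing some difference
  have hrD : ∀ l, ∃ r, l ∈ LD → (∀ k < K, ¬ l ^ 2 ∣ r + h k) ∧
      ∀ i j, i < j → j < K → l ∣ h j - h i → l ∣ r + h i := by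
    intro l
    by_cases hl : l ∈ LD
    · obtain ⟨i, j, hij, hj, hd⟩ := hLDpair l hl
      have h1 := hsep l (hLDp l hl) (hLDQ l hl)
      obtain ⟨r, hr⟩ := exists_residue_of_pair (hLDp l hl) (hgt l (hLDp l hl) (hLDQ l hl)).2
        hmono h1.1 h1.2 hij hj hd
      refine ⟨r, fun _ => ⟨fun k hk => (hr k hk).1, fun i' j' hij' hj' hd' => ?_⟩⟩
      exact (hr i' (hij'.trans hj')).2.2 (Or.inl (h1.2 i' j' i j hij' hj' hij hj hd' hd).1)
    · exact ⟨0, fun h => absurd h hl⟩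
  choose rD hrD using hrD
  set F := firstPrimes k₂ \ (Q ∪ LD) with hF
  have hFp : ∀ l ∈ F, l.Prime := fun l hl => prime_of_mem_firstPrimes (mem_sdiff.1 hl).1
  have hFn : ∀ l ∈ F, l ∉ Q ∧ l ∉ LD := fun l hl => by
    have := (mem_sdiff.1 hl).2
    simpa [not_or] using this
  have hFc : K * #LD ≤ #F := by
    have h1 := le_card_sdiff (Q ∪ LD) (firstPrimes k₂)
    have h2 := card_union_le Q LD
    rw [card_firstPrimes, ← hF] at h1
    have h3 : K * #LD + #Q + #LD ≤ k₂ := by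
      calc K * #LD + #Q + #LD ≤ g * g ^ 22 + g ^ 23 + g ^ 23 := by
            gcongr
            · exact hQc.trans (Nat.le_self_pow (by norm_num) g)
            · exact hLDc.trans (Nat.pow_le_pow_right (by omega) (by norm_num))
        _ = 3 * g ^ 23 := by ring
        _ ≤ g * g ^ 23 := by gcongr; omega
        _ = k₂ := by rw [hk]; ring
    omega
  obtain ⟨f, hf⟩ := exists_card_fiber_eq F (fun k => #LD - #{l ∈ LD | l ∣ rD l + h k}) K (by
    refine le_trans (sum_le_card_nsmul _ _ #LD fun k _ => Nat.sub_le _ _) ?_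
    simpa using hFc)
  have hrF : ∀ l, ∃ r, l ∈ F → ∀ k < K, ¬ l ^ 2 ∣ r + h k ∧ (l ∣ r + h k ↔ f l = k) := by
    intro l
    by_cases hl : l ∈ F
    · obtain ⟨r, hr⟩ := exists_residue_of_index (hFp l hl) (hgt l (hFp l hl) (hFn l hl).1).1
        (hnLD l (hFp l hl) (hFn l hl).1 (hFn l hl).2) (f l)
      exact ⟨r, fun _ => hr⟩
    · exact ⟨0, fun h => absurd h hl⟩
  choose rF hrF using hrF
  have hdisj : Disjoint LD F := disjoint_left.2 fun l h1 h2 => (hFn l h2).2 h1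
  refine ⟨LD ∪ F, fun l => if l ∈ LD then rD l else rF l, #LD, fun l hl => ?_, fun l hl hlQ => ?_,
    ?_, fun l hl k hk => ?_, fun l hl hlQ i j hij hj hd => ?_, fun k hk => ?_⟩
  · rcases mem_union.1 hl with h1 | h1
    exacts [⟨hLDp l h1, hLDQ l h1⟩, ⟨hFp l h1, (hFn l h1).1⟩]
  · by_cases h1 : l ∈ LD
    · exact mem_union_left _ h1
    · exact mem_union_right _ (mem_sdiff.2 ⟨hl, by simp [hlQ, h1]⟩)
  · rw [prod_union hdisj]
    refine mul_le_two_pow hg2 (le_two_pow_mono hg2 hLDb (by norm_num)) ?_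
    have h1 : ∏ l ∈ F, l ≤ ∏ l ∈ firstPrimes k₂, l :=
      Nat.le_of_dvd (prod_pos fun l hl => (prime_of_mem_firstPrimes hl).pos)
        (prod_dvd_prod_of_subset _ _ _ sdiff_subset)
    refine h1.trans ((prod_firstPrimes_le k₂).trans (le_of_eq ?_))
    rw [hk]; ring
  · by_cases h1 : l ∈ LD
    · simpa only [h1, if_true] using (hrD l h1).1 k hk
    · simpa only [h1, if_false] using (hrF l ((mem_union.1 hl).resolve_left h1) k hk).1
  · have h1 : l ∈ LD := by
      by_contra h1
      exact hnLD l hl hlQ h1 i j hij hj hd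
    refine ⟨mem_union_left _ h1, ?_⟩
    simpa only [h1, if_true] using (hrD l h1).2 i j hij hj hd
  · rw [filter_union, card_union_of_disjoint (disjoint_filter_filter hdisj)]
    have h1 : {l ∈ LD | l ∣ (if l ∈ LD then rD l else rF l) + h k} =
        {l ∈ LD | l ∣ rD l + h k} := filter_congr fun l hl => by simp only [hl, if_true]
    have h2 : {l ∈ F | l ∣ (if l ∈ LD then rD l else rF l) + h k} = {l ∈ F | f l = k} :=
      filter_congr fun l hl => by
        simp only [(hFn l hl).2, if_false]; exact (hrF l hl k hk).2
    rw [h1, h2, hf k hk]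
    have := card_filter_le LD fun l => l ∣ rD l + h k
    omega

open scoped Classical in
lemma exists_shift_pair {K M g : ℕ} (hK : 2 ≤ K) (hM : 0 < M) (hKg : K ≤ g) (hg : 4 ≤ g)
    (hV : 8 * K * (2 + g ^ 53) ≤ 2 ^ (K - 1)) (Q : Finset ℕ) (hQp : ∀ q ∈ Q, q.Prime)
    (hQ : ∀ l, l.Prime → l ∉ Q → K ^ 2 < l) (hG : ∏ q ∈ Q, q ^ M ≤ 2 ^ g ^ 1) (h : ℕ → ℕ)
    (hb : ∀ i < K, 0 < h i ∧ h i ≤ 2 ^ g ^ 20) (hmono : ∀ i j, i < j → j < K → h i < h j)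
    (hsep : ∀ l, l.Prime → l ∉ Q → (∀ i j, i < j → j < K → ¬ l ^ 2 ∣ h j - h i) ∧
        ∀ i j k m, i < j → j < K → k < m → m < K → l ∣ h j - h i → l ∣ h m - h k →
          i = k ∧ j = m) :
    ∃ N i j, i < j ∧ j < K ∧ (∀ q ∈ Q, q ^ M ∣ N) ∧
      (∀ l, l.Prime → l ∉ Q → ¬ l ^ 2 ∣ N + h i ∧ ¬ l ^ 2 ∣ N + h j ∧
        (l ∣ h j - h i → l ∣ N + h i)) ∧
      #{l ∈ (N + h i).primeFactors | l ∉ Q} = #{l ∈ (N + h j).primeFactors | l ∉ Q} := by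
  have hg2 : 2 ≤ g := by omega
  have hQc : #Q ≤ g := by
    have h1 := card_le_of_prod_le_two_pow (S := Q) (f := fun q => q ^ M) (fun q hq =>
      (hQp q hq).two_le.trans (Nat.le_self_pow hM.ne' q)) hG
    rwa [pow_one] at h1
  obtain ⟨L, r, c, hL, hLf, hLb, hLsq, hLD, hLc⟩ := exists_balanced_residues hKg hg Q hQ hQc h
    (fun i hi => (hb i hi).2) hmono hsep hK rfl
  have hdisj : Disjoint Q L := disjoint_left.2 fun l h1 h2 => (hL l h2).2 h1
  have hUp : ∀ l ∈ Q ∪ L, l.Prime := fun l hl =>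
    (mem_union.1 hl).elim (hQp l) fun h1 => (hL l h1).1
  obtain ⟨N₀, hN₀, hmod⟩ := exists_modEq_of_primes (Q ∪ L) hUp (fun l => if l ∈ Q then M else 2)
    (fun l => if l ∈ Q then 0 else r l)
  set P := ∏ l ∈ Q ∪ L, l ^ (if l ∈ Q then M else 2) with hP
  have hP0 : 0 < P := prod_pos fun l hl => pow_pos (hUp l hl).pos _
  have hPb : P ≤ 2 ^ g ^ 51 := by
    have h1 : P = (∏ q ∈ Q, q ^ M) * ((∏ l ∈ L, l) * ∏ l ∈ L, l) := by
      rw [hP, prod_union hdisj, ← prod_mul_distrib]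
      congr 1
      · exact prod_congr rfl fun l hl => by simp only [hl, if_true]
      · exact prod_congr rfl fun l hl => by simp only [(hL l hl).2, if_false, sq]
    rw [h1]
    exact mul_le_two_pow hg2 (le_two_pow_mono hg2 hG (by norm_num)) (mul_le_two_pow hg2 hLb hLb)
  have hQP : ∀ q ∈ Q, q ^ M ∣ P := fun q hq => by
    simpa only [hq, if_true] using dvd_prod_of_mem (fun l => l ^ (if l ∈ Q then M else 2))
      (mem_union_left L hq)
  have hLP : ∀ l ∈ L, l ^ 2 ∣ P := fun l hl => by
    simpa only [(hL l hl).2, if_false] using dvd_prod_of_mem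
      (fun l => l ^ (if l ∈ Q then M else 2)) (mem_union_right Q hl)
  have hdvdP : ∀ l, l.Prime → (l ∣ P ↔ l ∈ Q ∨ l ∈ L) := by
    intro l hl
    refine ⟨fun hd => ?_, fun hd => ?_⟩
    · obtain ⟨q, hq, hlq⟩ := (hl.prime.dvd_finsetProd_iff _).1 hd
      rw [(Nat.prime_dvd_prime_iff_eq hl (hUp q hq)).1 (hl.dvd_of_dvd_pow hlq)]
      exact mem_union.1 hq
    · rcases hd with hd | hd
      · exact (dvd_pow_self l hM.ne').trans (hQP l hd)
      · exact (dvd_pow_self l two_ne_zero).trans (hLP l hd)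
  have h12 : 12 ≤ 2 ^ g ^ 1 := by
    calc 12 ≤ 2 ^ 4 := by norm_num
      _ ≤ _ := Nat.pow_le_pow_right (by norm_num) (by rwa [pow_one])
  obtain ⟨t, ht⟩ := exists_few_prime_factors (K := K) (P := P) (A := 2 ^ g ^ 52) (L := g ^ 53)
    (by omega) hP0 (le_two_pow_mono hg2 hPb (by norm_num)) (fun k => N₀ + h k)
    (fun k hk => ⟨Nat.add_pos_right _ (hb k hk).1, add_le_two_pow hg2 (hN₀.le.trans hPb)
      (le_two_pow_mono hg2 (hb k hk).2 (by norm_num))⟩)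
    (mul_le_two_pow hg2 (le_two_pow_mono hg2 (mul_le_two_pow hg2 h12
      (le_two_pow_of_le hKg)) (by norm_num)) le_rfl) hV
  set N := N₀ + P * t with hN
  have hNh : ∀ k, P * t + (N₀ + h k) = N + h k := fun k => by rw [hN]; ring
  simp only [hNh] at ht
  have hmodL : ∀ l ∈ L, ∀ k, N + h k ≡ r l + h k [MOD l ^ 2] := by
    intro l hl k
    have h1 := hmod l (mem_union_right _ hl)
    simp only [(hL l hl).2, if_false] at h1
    refine Nat.ModEq.add_right _ ?_
    simpa using h1.add (Nat.modEq_zero_iff_dvd.2 ((hLP l hl).mul_right t))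
  have hdvdL : ∀ l ∈ L, ∀ k, l ∣ N + h k ↔ l ∣ r l + h k := fun l hl k =>
    (hmodL l hl k).dvd_iff (dvd_pow_self l two_ne_zero)
  have hsq : ∀ l, l.Prime → l ∉ Q → ∀ k < K, ¬ l ^ 2 ∣ N + h k := by
    intro l hl hlQ k hk
    by_cases hlL : l ∈ L
    · rw [(hmodL l hlL k).dvd_iff dvd_rfl]
      exact hLsq l hlL k hk
    · refine (ht k hk).1 l hl (by rw [hdvdP l hl]; tauto) ?_
      refine lt_of_le_of_lt ?_ (lt_of_notMem_firstPrimes hl fun h1 => hlL (hLf l h1 hlQ))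
      calc 8 * K ≤ 4 * 4 * g := by omega
        _ ≤ g * g * g := by gcongr
        _ = g ^ 3 := by ring
        _ ≤ g ^ 24 := Nat.pow_le_pow_right (by omega) (by norm_num)
  have hcount : ∀ k < K, #{l ∈ (N + h k).primeFactors | l ∉ Q} =
      #{l ∈ (N + h k).primeFactors | ¬ l ∣ P} + c := by
    intro k hk
    have h0 : N + h k ≠ 0 := (Nat.add_pos_right _ (hb k hk).1).ne'
    rw [← hLc k hk, ← card_union_of_disjoint]
    · congr 1
      ext l
      simp only [mem_union, mem_filter, Nat.mem_primeFactors]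
      constructor
      · rintro ⟨⟨hl, hd, -⟩, hlQ⟩
        by_cases hlL : l ∈ L
        · exact Or.inr ⟨hlL, (hdvdL l hlL k).1 hd⟩
        · exact Or.inl ⟨⟨hl, hd, h0⟩, by rw [hdvdP l hl]; tauto⟩
      · rintro (⟨⟨hl, hd, -⟩, hlP⟩ | ⟨hlL, hd⟩)
        · exact ⟨⟨hl, hd, h0⟩, fun h1 => hlP ((hdvdP l hl).2 (Or.inl h1))⟩
        · exact ⟨⟨(hL l hlL).1, (hdvdL l hlL k).2 hd, h0⟩, (hL l hlL).2⟩
    · refine disjoint_left.2 fun l h1 h2 => ?_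
      simp only [mem_filter, Nat.mem_primeFactors] at h1 h2
      exact h1.2 ((hdvdP l h1.1.1).2 (Or.inr h2.1))
  have hlt : ∀ k ∈ range K, #{l ∈ (N + h k).primeFactors | ¬ l ∣ P} ∈ range (K - 1) := by
    intro k hk
    exact mem_range.2 ((Nat.pow_lt_pow_iff_right one_lt_two).1 (ht k (mem_range.1 hk)).2)
  obtain ⟨i, hi, j, hj, hij, heq⟩ := exists_ne_map_eq_of_card_lt_of_maps_to
    (by simp only [card_range]; omega) hlt
  rw [mem_range] at hi hj
  have main : ∀ i j, i < j → j < K → #{l ∈ (N + h i).primeFactors | ¬ l ∣ P} =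
      #{l ∈ (N + h j).primeFactors | ¬ l ∣ P} → ∃ N i j, i < j ∧ j < K ∧ (∀ q ∈ Q, q ^ M ∣ N) ∧
      (∀ l, l.Prime → l ∉ Q → ¬ l ^ 2 ∣ N + h i ∧ ¬ l ^ 2 ∣ N + h j ∧
        (l ∣ h j - h i → l ∣ N + h i)) ∧
      #{l ∈ (N + h i).primeFactors | l ∉ Q} = #{l ∈ (N + h j).primeFactors | l ∉ Q} := by
    intro i j hij hj heq
    refine ⟨N, i, j, hij, hj, fun q hq => ?_, fun l hl hlQ => ⟨hsq l hl hlQ i (hij.trans hj),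
      hsq l hl hlQ j hj, fun hd => ?_⟩, ?_⟩
    · have h1 := hmod q (mem_union_left _ hq)
      simp only [hq, if_true] at h1
      exact dvd_add (Nat.modEq_zero_iff_dvd.1 h1) ((hQP q hq).mul_right t)
    · obtain ⟨h1, h2⟩ := hLD l hl hlQ i j hij hj hd
      exact (hdvdL l h1 i).2 h2
    · rw [hcount i (hij.trans hj), hcount j hj, heq]
  rcases lt_or_gt_of_ne hij with h1 | h1
  · exact main i j h1 hj heq
  · exact main j i h1 hi heq.symm

lemma exponentPattern_eq_of_sum_eq {x y : ℕ} (h : ∀ F : ℕ → ℕ, F 0 = 0 →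
    ∑ p ∈ x.primeFactors, F (x.factorization p) = ∑ p ∈ y.primeFactors, F (y.factorization p)) :
    exponentPattern x = exponentPattern y := by
  have key : ∀ m c, Multiset.count c (exponentPattern m) =
      ∑ p ∈ m.primeFactors, if c = m.factorization p then 1 else 0 := by
    intro m c
    rw [exponentPattern, Multiset.count_map, sum_boole, Nat.cast_id, ← Nat.support_factorization]
    rfl
  ext c
  rw [key, key]
  rcases eq_or_ne c 0 with rfl | hc
  · have hz : ∀ m : ℕ, ∑ p ∈ m.primeFactors, (if 0 = m.factorization p then 1 else 0) = 0 := by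
      intro m
      refine sum_eq_zero fun p hp => if_neg (Ne.symm ?_)
      rwa [← Nat.support_factorization, Finsupp.mem_support_iff] at hp
    rw [hz, hz]
  · exact h (fun e => if c = e then 1 else 0) (if_neg hc)

open scoped Classical in
lemma sum_primeFactors_eq {m : ℕ} {Q : Finset ℕ} {F : ℕ → ℕ} (hF : F 0 = 0)
    (h : ∀ l, l.Prime → l ∉ Q → m.factorization l ≤ 1) :
    ∑ p ∈ m.primeFactors, F (m.factorization p) =
      ∑ q ∈ Q, F (m.factorization q) + #{l ∈ m.primeFactors | l ∉ Q} * F 1 := by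
  rw [← sum_filter_add_sum_filter_not m.primeFactors (· ∈ Q)]
  congr 1
  · refine sum_subset (fun p hp => (mem_filter.1 hp).2) fun q hq hn => ?_
    have h1 : q ∉ m.primeFactors := fun h1 => hn (mem_filter.2 ⟨h1, hq⟩)
    rw [← Nat.support_factorization, Finsupp.notMem_support_iff] at h1
    rw [h1, hF]
  · rw [← smul_eq_mul, ← sum_const]
    refine sum_congr rfl fun l hl => ?_
    obtain ⟨h1, h2⟩ := mem_filter.1 hl
    have h3 := h l (Nat.prime_of_mem_primeFactors h1) h2
    rw [← Nat.support_factorization, Finsupp.mem_support_iff] at h1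
    congr 1
    omega

open scoped Classical in
lemma exists_exponentPattern_eq {n a b : ℕ} (hn : 0 < n) (ha : 0 < a) (hab : a < b)
    (Q : Finset ℕ) (hmin : ∀ q ∈ Q, (b - a).factorization q =
      min (a.factorization q) (b.factorization q))
    (hbal : ∀ F : ℕ → ℕ, F 0 = 0 →
      ∑ q ∈ Q, F (n.factorization q + (a.factorization q - b.factorization q)) =
      ∑ q ∈ Q, F (n.factorization q + (b.factorization q - a.factorization q)))
    (hl : ∀ l, l.Prime → l ∉ Q → ¬ l ∣ n ∧ ¬ l ^ 2 ∣ a ∧ ¬ l ^ 2 ∣ b ∧ ¬ l ^ 2 ∣ b - a ∧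
      (l ∣ b - a → l ∣ a))
    (hc : #{l ∈ a.primeFactors | l ∉ Q} = #{l ∈ b.primeFactors | l ∉ Q}) :
    ∃ x, 0 < x ∧ exponentPattern x = exponentPattern (x + n) ∧
      ∀ q ∈ Q, x.factorization q = n.factorization q + (a.factorization q - b.factorization q) := by
  have hle1 : ∀ l, l.Prime → ∀ m, 0 < m → ¬ l ^ 2 ∣ m → m.factorization l ≤ 1 := by
    intro l hl m hm h
    by_contra! h1
    exact h ((hl.pow_dvd_iff_le_factorization hm.ne').2 h1)
  have hpos : ∀ l, l.Prime → ∀ m, 0 < m → l ∣ m → 1 ≤ m.factorization l := by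
    intro l hl m hm h
    exact (hl.dvd_iff_one_le_factorization hm.ne').1 h
  have hD0 : 0 < b - a := by omega
  obtain ⟨a', ha'⟩ : b - a ∣ a := by
    rw [← Nat.factorization_prime_le_iff_dvd hD0.ne' ha.ne']
    intro p hp
    by_cases hpQ : p ∈ Q
    · rw [hmin p hpQ]; exact min_le_left _ _
    · obtain ⟨-, -, -, h1, h2⟩ := hl p hp hpQ
      by_cases hd : p ∣ b - a
      · exact (hle1 p hp _ hD0 h1).trans (hpos p hp a ha (h2 hd))
      · rw [Nat.factorization_eq_zero_of_not_dvd hd]; exact Nat.zero_le _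
  set D := b - a with hD
  have hb' : b = D * (a' + 1) := by rw [mul_add, ← ha']; omega
  have ha0 : 0 < a' := Nat.pos_of_ne_zero fun h => by rw [h, mul_zero] at ha'; omega
  have hfac : ∀ m m', 0 < m' → m = D * m' → ∀ p,
      (n * m').factorization p + D.factorization p = n.factorization p + m.factorization p := by
    intro m m' hm' hm p
    rw [hm, Nat.factorization_mul hn.ne' hm'.ne', Nat.factorization_mul hD0.ne' hm'.ne']
    simp only [Finsupp.add_apply]; ring
  have hnl : ∀ l, l.Prime → l ∉ Q → n.factorization l = 0 := fun l hlp hlQ =>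
    Nat.factorization_eq_zero_of_not_dvd (hl l hlp hlQ).1
  have hcard : ∀ m m', 0 < m' → m = D * m' →
      (∀ l, l.Prime → l ∉ Q → m.factorization l ≤ 1) →
      #{l ∈ (n * m').primeFactors | l ∉ Q} + #{l ∈ D.primeFactors | l ∉ Q} =
        #{l ∈ m.primeFactors | l ∉ Q} := by
    intro m m' hm' hm hm1
    have hfm := hfac m m' hm' hm
    rw [← card_union_of_disjoint]
    · congr 1
      ext l
      simp only [mem_union, mem_filter, ← Nat.support_factorization, Finsupp.mem_support_iff]
      by_cases hlQ : l ∈ Q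
      · simp [hlQ]
      by_cases hlp : l.Prime
      · have h1 := hfm l
        have h2 := hnl l hlp hlQ
        simp only [hlQ, not_false_eq_true, and_true]
        omega
      · simp [Nat.factorization_eq_zero_of_not_prime, hlp]
    · refine disjoint_left.2 fun l h1 h2 => ?_
      obtain ⟨h1, hlQ⟩ := mem_filter.1 h1
      have h2 := (mem_filter.1 h2).1
      have hlp := Nat.prime_of_mem_primeFactors h1
      rw [← Nat.support_factorization, Finsupp.mem_support_iff] at h1 h2
      have h3 := hfm l
      have h4 := hnl l hlp hlQ
      have h5 := hm1 l hlp hlQ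
      omega
  have ha1 : ∀ l, l.Prime → l ∉ Q → a.factorization l ≤ 1 := fun l hlp hlQ =>
    hle1 l hlp a ha (hl l hlp hlQ).2.1
  have hb1 : ∀ l, l.Prime → l ∉ Q → b.factorization l ≤ 1 := fun l hlp hlQ =>
    hle1 l hlp b (by omega) (hl l hlp hlQ).2.2.1
  have hxQ : ∀ q ∈ Q, (n * a').factorization q =
      n.factorization q + (a.factorization q - b.factorization q) := by
    intro q hq
    have h1 := hfac a a' ha0 ha' q
    rw [hmin q hq] at h1
    omega
  have hyQ : ∀ q ∈ Q, (n * (a' + 1)).factorization q =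
      n.factorization q + (b.factorization q - a.factorization q) := by
    intro q hq
    have h1 := hfac b (a' + 1) (by omega) hb' q
    rw [hmin q hq] at h1
    omega
  refine ⟨n * a', by positivity, ?_, hxQ⟩
  rw [show n * a' + n = n * (a' + 1) by ring]
  refine exponentPattern_eq_of_sum_eq fun F hF => ?_
  rw [sum_primeFactors_eq (Q := Q) hF, sum_primeFactors_eq (Q := Q) hF,
    sum_congr rfl fun q hq => by rw [hxQ q hq], hbal F hF, sum_congr rfl fun q hq => by rw [← hyQ q hq]]
  · have h1 := hcard a a' ha0 ha' ha1
    have h2 := hcard b (a' + 1) (by omega) hb' hb1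
    congr 2
    omega
  · intro l hlp hlQ
    have h1 := hfac b (a' + 1) (by omega) hb' l
    have h2 := hb1 l hlp hlQ
    have h3 := hnl l hlp hlQ
    omega
  · intro l hlp hlQ
    have h1 := hfac a a' ha0 ha' l
    have h2 := ha1 l hlp hlQ
    have h3 := hnl l hlp hlQ
    omega

lemma sum_range_mul_div_mod (f : ℕ → ℕ → ℕ) {B : ℕ} (hB : 0 < B) (s : ℕ) :
    ∑ m ∈ range (s * B), f (m / B) (m % B) = ∑ a ∈ range s, ∑ b ∈ range B, f a b := by
  induction s with
  | zero => simp
  | succ s ih =>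
    rw [add_mul, one_mul, sum_range_add, ih, sum_range_succ]
    congr 1
    refine sum_congr rfl fun b hb => ?_
    rw [mem_range] at hb
    rw [mul_comm s B, Nat.mul_add_div hB, Nat.mul_add_mod, Nat.div_eq_of_lt hb, Nat.mod_eq_of_lt hb,
      add_zero]

/-- The exponents in the `a`-th block of `2 * K + 1` auxiliary primes, where `c` is the exponent to
be compensated. -/
def blockExponent (K c b i : ℕ) : ℕ :=
  if b = 0 then K - i
  else if b ≤ K then (if i < b - 1 then 0 else c + i - (b - 1))
  else c + K - (if i ≤ b - 1 - K then 0 else c + i - (b - 1 - K))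

lemma blockExponent_le (K c b i : ℕ) (hi : i < K) : blockExponent K c b i ≤ c + K := by
  unfold blockExponent
  split_ifs <;> omega

lemma sum_blockExponent {K c i j : ℕ} (hij : i < j) (hj : j < K) {F : ℕ → ℕ} (hF : F 0 = 0) :
    F c + ∑ b ∈ range (2 * K + 1), F (blockExponent K c b i - blockExponent K c b j) =
      F (c + (j - i)) +
        ∑ b ∈ range (2 * K + 1), F (blockExponent K c b j - blockExponent K c b i) := by
  have hsplit : ∀ f : ℕ → ℕ, ∑ b ∈ range (2 * K + 1), f b =
      f 0 + ∑ k ∈ range K, f (1 + k) + ∑ k ∈ range K, f (1 + K + k) := by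
    intro f
    rw [show 2 * K + 1 = 1 + K + K by ring, sum_range_add, sum_range_add, sum_range_one]
  have hT : ∀ k < K, ∀ i, blockExponent K c (1 + k) i = if i < k then 0 else c + i - k := by
    intro k hk i
    unfold blockExponent
    rw [if_neg (by omega), if_pos (by omega), Nat.add_sub_cancel_left]
  have hS : ∀ k < K, ∀ i, blockExponent K c (1 + K + k) i =
      c + K - if i ≤ k then 0 else c + i - k := by
    intro k hk i
    unfold blockExponent
    rw [if_neg (by omega), if_neg (by omega), show 1 + K + k - 1 - K = k by omega]
  have h0 : ∀ i, blockExponent K c 0 i = K - i := fun i => if_pos rfl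
  rw [hsplit, hsplit, h0, h0]
  have e1 : ∑ k ∈ range K, F (blockExponent K c (1 + k) i - blockExponent K c (1 + k) j) = 0 := by
    refine sum_eq_zero fun k hk => ?_
    rw [hT k (mem_range.1 hk), hT k (mem_range.1 hk), ← hF]
    congr 1
    split_ifs <;> omega
  have e2 : ∑ k ∈ range K,
      F (blockExponent K c (1 + K + k) j - blockExponent K c (1 + K + k) i) = 0 := by
    refine sum_eq_zero fun k hk => ?_
    rw [hS k (mem_range.1 hk), hS k (mem_range.1 hk), ← hF]
    congr 1
    split_ifs <;> omega
  have e3 : ∑ k ∈ range K, (F (blockExponent K c (1 + k) j - blockExponent K c (1 + k) i) +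
        if k = i then F (c + (j - i)) else 0) =
      ∑ k ∈ range K, (F (blockExponent K c (1 + K + k) i - blockExponent K c (1 + K + k) j) +
        (if k = i then F (j - i) else 0) + if k = j then F c else 0) := by
    refine sum_congr rfl fun k hk => ?_
    rw [mem_range] at hk
    rw [hT k hk, hT k hk, hS k hk, hS k hk]
    rcases lt_trichotomy k i with h | rfl | h
    · rw [if_neg (by omega), if_neg (by omega), if_neg (by omega), if_neg (by omega),
        if_neg (by omega), if_neg (by omega), if_neg (by omega)]
      simp only [add_zero]
      congr 1; omega
    · rw [if_neg (by omega), if_neg (by omega), if_pos rfl, if_pos le_rfl, if_neg (by omega),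
        if_pos rfl, if_neg (by omega), add_zero, add_comm]
      congr 2 <;> omega
    · rcases lt_trichotomy k j with h' | rfl | h'
      · rw [if_neg (by omega), if_pos h, if_neg (by omega), if_pos (by omega), if_neg (by omega),
          if_neg (by omega), if_neg (by omega)]
        simp only [add_zero]
        congr 1; omega
      · rw [if_neg (by omega), if_pos h, if_neg (by omega), if_pos (by omega), if_pos le_rfl,
          if_neg (by omega), if_pos rfl, Nat.sub_self, hF]
        simp
      · rw [if_pos h', if_pos h, if_neg (by omega), if_pos (by omega), if_pos (by omega),
          if_neg (by omega), if_neg (by omega), Nat.sub_self, Nat.sub_self]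
  rw [sum_add_distrib, sum_add_distrib, sum_add_distrib, sum_ite_eq', sum_ite_eq', sum_ite_eq',
    if_pos (mem_range.2 (hij.trans hj)), if_pos (mem_range.2 (hij.trans hj)),
    if_pos (mem_range.2 hj)] at e3
  rw [e1, e2, show K - i - (K - j) = j - i by omega, show K - j - (K - i) = 0 by omega, hF]
  omega

/-- The exponent of the prime with index `m` in the term with index `i`; the first `s` primes get
the exponent `i`, and each of them has a block of compensating primes. -/
def indexExponent (s K : ℕ) (v : ℕ → ℕ) (m i : ℕ) : ℕ :=
  if m < s then i
  else blockExponent K (v ((m - s) / (2 * K + 1))) ((m - s) % (2 * K + 1)) i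

lemma indexExponent_lt {s K : ℕ} {v : ℕ → ℕ} (hv : ∀ m, v m ≤ K) (m : ℕ) {i : ℕ} (hi : i < K) :
    indexExponent s K v m i < 4 * K := by
  unfold indexExponent
  split_ifs
  · omega
  · have h1 := blockExponent_le K (v ((m - s) / (2 * K + 1))) ((m - s) % (2 * K + 1)) i hi
    have h2 := hv ((m - s) / (2 * K + 1))
    omega

lemma indexExponent_self (s K : ℕ) (v : ℕ → ℕ) (i : ℕ) : indexExponent s K v s i = K - i := by
  simp [indexExponent, blockExponent]

lemma sum_indexExponent {s K i j : ℕ} {v : ℕ → ℕ} (hv : ∀ m, s ≤ m → v m = 0) (hij : i < j)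
    (hj : j < K) {F : ℕ → ℕ} (hF : F 0 = 0) :
    ∑ m ∈ range (s * (2 * K + 2)),
        F (v m + (indexExponent s K v m i - indexExponent s K v m j)) =
      ∑ m ∈ range (s * (2 * K + 2)),
        F (v m + (indexExponent s K v m j - indexExponent s K v m i)) := by
  have key : ∀ i j, ∑ m ∈ range (s * (2 * K + 2)),
        F (v m + (indexExponent s K v m i - indexExponent s K v m j)) =
      ∑ a ∈ range s, (F (v a + (i - j)) + ∑ b ∈ range (2 * K + 1),
        F (blockExponent K (v a) b i - blockExponent K (v a) b j)) := by
    intro i j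
    rw [show s * (2 * K + 2) = s + s * (2 * K + 1) by ring, sum_range_add, sum_add_distrib,
      ← sum_range_mul_div_mod (fun a b =>
        F (blockExponent K (v a) b i - blockExponent K (v a) b j)) (by omega)]
    congr 1
    · refine sum_congr rfl fun a ha => ?_
      simp only [indexExponent, mem_range.1 ha, if_true]
    · refine sum_congr rfl fun m _ => ?_
      rw [hv _ (Nat.le_add_right s m), zero_add]
      simp only [indexExponent, Nat.add_sub_cancel_left]
      rw [if_neg (by omega), if_neg (by omega)]
  rw [key, key]
  refine sum_congr rfl fun a _ => ?_
  rw [Nat.sub_eq_zero_of_le hij.le, add_zero]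
  exact sum_blockExponent hij hj hF

lemma exists_le_and_pow_le_two_pow (m d : ℕ) (hd : 0 < d) :
    ∃ K, m ≤ K ∧ 8 * K * (2 + K ^ d) ≤ 2 ^ (K - 1) := by
  have h := (tendsto_pow_const_div_const_pow_of_one_lt (d + 1)
    (one_lt_two : (1 : ℝ) < 2)).eventually (gt_mem_nhds (show (0 : ℝ) < 1 / 32 by norm_num))
  obtain ⟨K, hK, hm⟩ := (h.and (Filter.eventually_ge_atTop (m + 2))).exists
  refine ⟨K, by omega, ?_⟩
  rw [div_lt_iff₀ (by positivity)] at hK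
  have h1 : 32 * (K * K ^ d) ≤ 2 ^ K := by
    have h2 : 32 * ((K : ℝ) * (K : ℝ) ^ d) ≤ 2 ^ K := by rw [← pow_succ']; linarith
    exact_mod_cast h2
  obtain ⟨k, rfl⟩ := Nat.exists_eq_add_of_le' (show 1 ≤ K by omega)
  rw [Nat.add_sub_cancel]
  rw [pow_succ 2 k] at h1
  have h2 : 2 ≤ (k + 1) ^ d := (by omega : 2 ≤ k + 1).trans (Nat.le_self_pow hd.ne' _)
  have h3 : 8 * (k + 1) * (2 + (k + 1) ^ d) ≤ 8 * (k + 1) * (2 * (k + 1) ^ d) := by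
    gcongr; omega
  linarith

lemma exists_gt_exponentPattern_eq {n K : ℕ} (hn : 0 < n) (hnK : n ≤ K) (hK : 4 ≤ K)
    (hV : 8 * K * (2 + (K ^ 10) ^ 53) ≤ 2 ^ (K - 1)) :
    ∃ x, K < x ∧ exponentPattern x = exponentPattern (x + n) := by
  set s := K ^ 2 with hs
  have hKs : K ≤ s := Nat.le_self_pow two_ne_zero K
  set κ := s * (2 * K + 2) with hκ
  have hsκ : s < κ := by
    have : s * 1 < s * (2 * K + 2) := by gcongr; omega
    omega
  set Q := firstPrimes κ with hQdef
  have hQp : ∀ q ∈ Q, q.Prime := fun q hq => prime_of_mem_firstPrimes hq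
  have hQκ : ∀ l, l.Prime → l ∉ Q → κ < l := fun l hl hlQ => lt_of_notMem_firstPrimes hl hlQ
  have hQ : ∀ l, l.Prime → l ∉ Q → K ^ 2 < l := fun l hl hlQ => hsκ.trans (hQκ l hl hlQ)
  have hKg : K ≤ K ^ 10 := Nat.le_self_pow (by norm_num) K
  have hG : ∏ q ∈ Q, q ^ (4 * K) ≤ 2 ^ (K ^ 10) ^ 1 := by
    have h1 : κ ≤ K ^ 4 := by
      calc κ ≤ K ^ 2 * (K * K) := by rw [hκ, hs]; gcongr; nlinarith
        _ = K ^ 4 := by ring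
    rw [prod_pow, pow_one]
    calc (∏ q ∈ Q, q) ^ (4 * K) ≤ (2 ^ (κ * κ)) ^ (4 * K) :=
          Nat.pow_le_pow_left (prod_firstPrimes_le κ) _
      _ = 2 ^ (κ * κ * (4 * K)) := by rw [← pow_mul]
      _ ≤ 2 ^ (K ^ 4 * K ^ 4 * (K * K)) := by gcongr; norm_num
      _ = 2 ^ K ^ 10 := by congr 1; ring
  set v : ℕ → ℕ := fun m => n.factorization (Nat.nth Nat.Prime m) with hv
  have hvK : ∀ m, v m ≤ K := fun m => (Nat.factorization_lt _ hn.ne').le.trans hnK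
  have hvs : ∀ m, s ≤ m → v m = 0 := by
    intro m hm
    refine Nat.factorization_eq_zero_of_not_dvd fun hd => ?_
    have h1 := Nat.le_of_dvd hn hd
    have h2 := Nat.add_two_le_nth_prime m
    omega
  set e : ℕ → ℕ → ℕ := fun q i => indexExponent s K v (Nat.count Nat.Prime q) i with he
  have hcount : ∀ m, Nat.count Nat.Prime (Nat.nth Nat.Prime m) = m :=
    Nat.count_nth_of_infinite Nat.infinite_setOfPred_prime
  obtain ⟨h, hb, hmono, hexp, hdiff, hsep⟩ := exists_shifts (M := 4 * K) (by omega) hKg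
    (hK.trans hKg) Q hQp hQ hG e (fun q _ i hi => indexExponent_lt hvK _ hi)
    (fun q hq hqK i j hij hj => by
      have h1 : Nat.count Nat.Prime q < s := by
        have h2 := Nat.add_two_le_nth_prime (Nat.count Nat.Prime q)
        rw [Nat.nth_count (hQp q hq)] at h2
        omega
      simp only [he, indexExponent, h1, if_true]
      exact hij.ne)
  obtain ⟨N, i, j, hij, hj, hNQ, hNl, hNc⟩ := exists_shift_pair (by omega) (by omega) hKg
    (hK.trans hKg) hV Q hQp hQ hG h hb hmono hsep
  have hi := hij.trans hj
  have hlt := hmono i j hij hj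
  have hfac : ∀ q ∈ Q, ∀ k < K, (N + h k).factorization q = e q k := by
    intro q hq k hk
    obtain ⟨h1, h2⟩ := hexp q hq k hk
    have h3 : q ^ (e q k + 1) ∣ N :=
      (pow_dvd_pow q (indexExponent_lt hvK _ hk)).trans (hNQ q hq)
    have h0 : N + h k ≠ 0 := (Nat.add_pos_right _ (hb k hk).1).ne'
    refine le_antisymm ?_ ?_
    · by_contra! hc
      refine h2 ((Nat.dvd_add_right h3).1 ?_)
      exact ((hQp q hq).pow_dvd_iff_le_factorization h0).2 hc
    · rw [← (hQp q hq).pow_dvd_iff_le_factorization h0]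
      exact dvd_add ((pow_dvd_pow q (Nat.le_succ _)).trans h3) h1
  have hsub : N + h j - (N + h i) = h j - h i := Nat.add_sub_add_left _ _ _
  have hsum : ∀ f : ℕ → ℕ, ∑ q ∈ Q, f q = ∑ m ∈ range κ, f (Nat.nth Nat.Prime m) := fun f =>
    sum_image fun a _ b _ hab => nth_prime_injective hab
  obtain ⟨x, hx0, hx, hxQ⟩ := exists_exponentPattern_eq (a := N + h i) (b := N + h j) hn
    (Nat.add_pos_right _ (hb i hi).1) (by omega) Q
    (fun q hq => by
      rw [hsub, hfac q hq i hi, hfac q hq j hj]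
      obtain ⟨h1, h2⟩ := hdiff q hq i j hij hj
      have h0 : h j - h i ≠ 0 := by omega
      rw [(hQp q hq).pow_dvd_iff_le_factorization h0] at h1 h2
      omega)
    (fun F hF => by
      have h1 : ∀ i < K, ∀ j < K, ∑ q ∈ Q, F (n.factorization q +
          ((N + h i).factorization q - (N + h j).factorization q)) =
          ∑ m ∈ range κ, F (v m + (indexExponent s K v m i - indexExponent s K v m j)) := by
        intro i hi j hj
        rw [sum_congr rfl fun q hq => by rw [hfac q hq i hi, hfac q hq j hj], hsum]
        simp only [he, hcount, hv]
      rw [h1 i hi j hj, h1 j hj i hi]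
      exact sum_indexExponent hvs hij hj hF)
    (fun l hl hlQ => by
      obtain ⟨h1, h2, h3⟩ := hNl l hl hlQ
      rw [hsub]
      refine ⟨fun hd => ?_, h1, h2, (hsep l hl hlQ).1 i j hij hj, h3⟩
      have h4 := Nat.le_of_dvd hn hd
      have h5 := hQ l hl hlQ
      omega) hNc
  refine ⟨x, ?_, hx⟩
  have hq : Nat.nth Nat.Prime s ∈ Q := mem_image_of_mem _ (mem_range.2 hsκ)
  have h1 := hxQ _ hq
  rw [hfac _ hq i hi, hfac _ hq j hj] at h1
  simp only [he, hcount, indexExponent_self] at h1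
  have h2 : Nat.nth Nat.Prime s ∣ x := Nat.dvd_of_factorization_pos (by omega)
  have h3 := Nat.le_of_dvd hx0 h2
  have h4 := Nat.add_two_le_nth_prime s
  omega

/-- For every positive integer `n`, there are infinitely many positive integers `x`
such that `x` and `x + n` have the same exponent pattern. -/
theorem stmt_6 (n : ℕ) (hn : 0 < n) :
    {x : ℕ | 0 < x ∧ exponentPattern x = exponentPattern (x + n)}.Infinite := by
  refine Set.infinite_of_forall_exists_gt fun m => ?_
  obtain ⟨K, hK, hV⟩ := exists_le_and_pow_le_two_pow (m + n + 4) (10 * 53) (by norm_num)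
  rw [pow_mul] at hV
  obtain ⟨x, hx, hxn⟩ := exists_gt_exponentPattern_eq hn (by omega) (by omega) hV
  exact ⟨x, ⟨by omega, hxn⟩, by omega⟩
end
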